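/- Let p be an odd prime, Ψ an unramified extension of ℚ_p with uniformizer π, and Ψ_∞/Ψ a totally ramified ℤ_p-extension with n-th layer Ψ_n. Let χ be a finite character of Gal(Ψ_∞/Ψ) of order p^n > 1 and Γ_n = Gal(Ψ_n/Ψ). Then v_π(⟨α|χ⟩_{Γ_n}) ≥ (n+1)/2 for every α in the ring of integers O_{Ψ_n}, and equality v_π(⟨α|χ⟩_{Γ_n}) = (n+1)/2 holds for every uniformizer α of Ψ_n. -/

import Mathlib

noncomputable section

open scoped Classical

/-- An additive `ℚ ∪ {∞}`-valued valuation on a field `A`, normalized by `v p = 1`.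
This models the `p`-adic valuation `v_p` on (an algebraic closure of) `ℚ_p`,
with the convention `v 0 = ∞`. -/
structure PadicValData (A : Type) [Field A] (p : ℕ) : Type where
  v : A → WithTop ℚ
  v_top_iff : ∀ x : A, v x = ⊤ ↔ x = 0
  v_mul : ∀ x y : A, v (x * y) = v x + v y
  v_min_le_add : ∀ x y : A, min (v x) (v y) ≤ v (x + y)
  v_coe_p : v (p : A) = 1

variable {p : ℕ} {A : Type} [Field A]

/-- `x ∈ F` is a uniformizer of the `p`-adic field `F` (embedded in `A` by `emb`):
its valuation is minimal among the positive valuations of elements of `F`. -/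
def IsUniformizer (vd : PadicValData A p) {F : Type} [Field F] (emb : F →+* A) (x : F) : Prop :=
  x ≠ 0 ∧ 0 < vd.v (emb x) ∧
    ∀ y : F, 0 < vd.v (emb y) → vd.v (emb x) ≤ vd.v (emb y)

/-- `y` belongs to the `j`-th power `m_F^j` of the maximal ideal of the ring of integers
`O_F` of `F` (embedded in `A` by `emb`): `y` is a multiple, by an element of `O_F`, of a
product of `j` elements of the maximal ideal `m_F`.  (For `j = 0` this says `y ∈ O_F`.) -/
def InMaxIdealPow (vd : PadicValData A p) {F : Type} [Field F] (emb : F →+* A) (j : ℕ)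
    (y : A) : Prop :=
  ∃ (u : F) (s : Fin j → F), 0 ≤ vd.v (emb u) ∧ (∀ k, 0 < vd.v (emb (s k))) ∧
    y = emb u * ∏ k, emb (s k)

/-- The lower-numbering ramification set
`G_i = {σ ∈ Gal(L/K) | ∀ x ∈ O_L, σ x - x ∈ m_L^{i+1}}` (with `G_i = G` for `i ≤ -1`). -/
def lowerRamSet (vd : PadicValData A p) (K L : Type) [Field K] [Field L] [Algebra K L]
    (emb : L →+* A) (i : ℤ) : Set (L ≃ₐ[K] L) :=
  {σ | ∀ x : L, 0 ≤ vd.v (emb x) →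
    InMaxIdealPow vd emb (i + 1).toNat (emb (σ x) - emb x)}

/-- The Herbrand function `φ_{L/K}(u) = ∫_0^u dt / (G_0 : G_t)`, where `G_t = G_{⌈t⌉}`. -/
noncomputable def herbrandPhi (vd : PadicValData A p) (K L : Type) [Field K] [Field L]
    [Algebra K L] (emb : L →+* A) (u : ℝ) : ℝ :=
  ∫ t in (0:ℝ)..u,
    (Nat.card ↥(lowerRamSet vd K L emb ⌈t⌉) : ℝ) /
      (Nat.card ↥(lowerRamSet vd K L emb 0) : ℝ)

/-- The Herbrand function `ψ_{L/K}`, the inverse of `φ_{L/K}`. -/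
noncomputable def herbrandPsi (vd : PadicValData A p) (K L : Type) [Field K] [Field L]
    [Algebra K L] (emb : L →+* A) (w : ℝ) : ℝ :=
  Function.invFun (herbrandPhi vd K L emb) w

/-- The upper-numbering ramification set `G^i = G_{ψ_{L/K}(i)}` of `Gal(L/K)`. -/
def upperRamSet (vd : PadicValData A p) (K L : Type) [Field K] [Field L] [Algebra K L]
    (emb : L →+* A) (i : ℤ) : Set (L ≃ₐ[K] L) :=
  lowerRamSet vd K L emb ⌈herbrandPsi vd K L emb (i : ℝ)⌉

/-- Condition (ram): the upper ramification groups of `L/K` satisfy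
`G = G^{-1} = G^0 ⊇ G^1 ⊋ G^2 ⊋ ⋯ ⊋ G^n ⊋ G^{n+1} = {1}`, with `G^i/G^{i+1}` of order `p`
for `1 ≤ i ≤ n` and `G^0/G^1` of order `p - 1`. -/
def RamCond (vd : PadicValData A p) (K L : Type) [Field K] [Field L] [Algebra K L]
    (emb : L →+* A) (n : ℕ) : Prop :=
  upperRamSet vd K L emb (-1) = Set.univ ∧
  upperRamSet vd K L emb 0 = Set.univ ∧
  (∀ i : ℤ, upperRamSet vd K L emb (i + 1) ⊆ upperRamSet vd K L emb i) ∧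
  Nat.card ↥(upperRamSet vd K L emb 0)
    = (p - 1) * Nat.card ↥(upperRamSet vd K L emb 1) ∧
  (∀ i : ℕ, 1 ≤ i → i ≤ n →
    Nat.card ↥(upperRamSet vd K L emb (i : ℤ))
      = p * Nat.card ↥(upperRamSet vd K L emb ((i : ℤ) + 1))) ∧
  upperRamSet vd K L emb ((n : ℤ) + 1) = {1}

/-- The local resolvent `⟨α|χ⟩ = ∑_{γ ∈ Gal(L/K)} χ(γ) γ(α)`, computed in `A`. -/
noncomputable def localResolvent (K L : Type) [Field K] [Field L] [Algebra K L]
    (emb : L →+* A) (χ : (L ≃ₐ[K] L) → A) (α : L) : A :=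
  ∑ᶠ γ : L ≃ₐ[K] L, χ γ * emb (γ α)


/-- `layer` is the tower of layers of a totally ramified `ℤ_p`-extension `Ψ_∞/Ψ`:
`layer n = Ψ_n` is the `n`-th layer, i.e. the unique subextension with
`Gal(Ψ_n/Ψ) ≅ ℤ/p^n`; each layer is Galois and cyclic of degree `p^n` over `Ψ`,
the layers are increasing with union `Ψ_∞`, and each `Ψ_n/Ψ` is totally ramified
(witnessed by a uniformizer of `Ψ_n` of valuation `p^{-n}`, `Ψ` being unramified
over `ℚ_p`). -/
def IsZpExtensionTower (vd : PadicValData A p) (Ψ Ψinf : Type) [Field Ψ] [Field Ψinf]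
    [Algebra Ψ Ψinf] (emb : Ψinf →+* A)
    (layer : ℕ → IntermediateField Ψ Ψinf) : Prop :=
  layer 0 = ⊥ ∧
  (∀ n, layer n ≤ layer (n + 1)) ∧
  (⨆ n, layer n) = ⊤ ∧
  (∀ n, IsGalois Ψ ↥(layer n)) ∧
  (∀ n, IsCyclic (↥(layer n) ≃ₐ[Ψ] ↥(layer n))) ∧
  (∀ n, Nat.card (↥(layer n) ≃ₐ[Ψ] ↥(layer n)) = p ^ n) ∧
  (∀ n, ∃ x : ↥(layer n),
    IsUniformizer vd (emb.comp ((layer n).val : ↥(layer n) →+* Ψinf)) x ∧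
    vd.v ((emb.comp ((layer n).val : ↥(layer n) →+* Ψinf)) x)
      = ((((p : ℚ) ^ n)⁻¹ : ℚ) : WithTop ℚ))

end

set_option linter.unusedSectionVars false
section basics
open Polynomial

structure LV {L : Type} [Field L] (w : L → WithTop ℚ) : Prop where
  top : ∀ x, w x = ⊤ ↔ x = 0
  mul : ∀ x y, w (x * y) = w x + w y
  add : ∀ x y, min (w x) (w y) ≤ w (x + y)

def gG {L : Type} (w : L → WithTop ℚ) (m : ℤ) (x : L) : Prop := ((m : ℚ) : WithTop ℚ) ≤ w x
def gE {L : Type} (w : L → WithTop ℚ) (m : ℤ) (x : L) : Prop := w x = ((m : ℚ) : WithTop ℚ)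

variable {L : Type} [Field L] {w : L → WithTop ℚ}

theorem LV.zero (h : LV w) : w 0 = ⊤ := (h.top 0).2 rfl

theorem LV.one (h : LV w) : w 1 = 0 := by
  have h1 := h.mul 1 1
  have h2 : w 1 ≠ ⊤ := fun h' => one_ne_zero ((h.top 1).1 h')
  lift w 1 to ℚ using h2 with q hq
  simp only [mul_one] at h1
  rw [← hq] at h1
  norm_cast at h1 ⊢
  linarith

theorem LV.neg_one (h : LV w) : w (-1) = 0 := by
  have h1 := h.mul (-1) (-1)
  have h2 : w (-1) ≠ ⊤ := fun h' => by
    have := (h.top (-1)).1 h'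
    simp at this
  rw [neg_one_mul, neg_neg, h.one] at h1
  lift w (-1) to ℚ using h2 with q hq
  norm_cast at h1 ⊢
  linarith

theorem LV.neg (h : LV w) (x : L) : w (-x) = w x := by
  rw [← neg_one_mul, h.mul, h.neg_one, zero_add]

theorem LV.sub (h : LV w) (x y : L) : min (w x) (w y) ≤ w (x - y) := by
  have := h.add x (-y)
  rwa [h.neg, ← sub_eq_add_neg] at this

theorem LV.ge_add (h : LV w) {r : WithTop ℚ} {x y : L} (hx : r ≤ w x) (hy : r ≤ w y) :
    r ≤ w (x + y) := le_trans (le_min hx hy) (h.add x y)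

theorem LV.ge_sum (h : LV w) {r : WithTop ℚ} {ι : Type} (s : Finset ι) (f : ι → L)
    (hf : ∀ i ∈ s, r ≤ w (f i)) : r ≤ w (∑ i ∈ s, f i) := by
  classical
  induction s using Finset.induction_on with
  | empty => simp [h.zero]
  | insert a s ha ih =>
    rw [Finset.sum_insert ha]
    exact h.ge_add (hf a (by simp)) (ih fun i hi => hf i (by simp [hi]))

theorem LV.eq_add (h : LV w) {x y : L} (hxy : w x < w y) : w (x + y) = w x := by
  apply le_antisymm
  · by_contra hc
    push Not at hc
    have := h.sub (x + y) y
    rw [add_sub_cancel_right] at this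
    exact absurd this (not_le.2 (lt_min hc hxy))
  · exact h.ge_add le_rfl hxy.le

theorem LV.pow (h : LV w) (x : L) (n : ℕ) : w (x ^ n) = n • w x := by
  induction n with
  | zero => simp [h.one]
  | succ n ih => rw [pow_succ, h.mul, ih, succ_nsmul]

theorem LV.prod (h : LV w) {ι : Type} (s : Finset ι) (f : ι → L) :
    w (∏ i ∈ s, f i) = ∑ i ∈ s, w (f i) := by
  classical
  induction s using Finset.induction_on with
  | empty => simp [h.one]
  | insert a s ha ih => rw [Finset.prod_insert ha, Finset.sum_insert ha, h.mul, ih]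

theorem LV.natCast (h : LV w) (n : ℕ) : 0 ≤ w (n : L) := by
  induction n with
  | zero => simp [h.zero]
  | succ n ih => push_cast; exact h.ge_add ih h.one.ge

theorem LV.intCast (h : LV w) (n : ℤ) : 0 ≤ w (n : L) := by
  obtain ⟨m, rfl | rfl⟩ := n.eq_nat_or_neg
  · exact_mod_cast h.natCast m
  · push_cast; rw [h.neg]; exact_mod_cast h.natCast m

/-- integers prime to p have valuation zero -/
theorem LV.natCast_coprime (h : LV w) {p : ℕ} (hp : p.Prime) (hpw : 0 < w (p : L)) {n : ℕ}
    (hn : ¬ p ∣ n) : w (n : L) = 0 := by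
  have hc : Nat.Coprime n p := ((Nat.Prime.coprime_iff_not_dvd hp).2 hn).symm
  have hb := Nat.isCoprime_iff_coprime.2 hc
  obtain ⟨a, b, hab⟩ := hb
  have hab' : (a : L) * n + b * p = 1 := by exact_mod_cast congrArg (Int.cast : ℤ → L) hab
  apply le_antisymm _ (h.natCast n)
  by_contra hlt
  push Not at hlt
  have h1 : 0 < w ((a : L) * n) := by
    rw [h.mul]; exact lt_of_lt_of_le hlt (le_add_of_nonneg_left (h.intCast a))
  have h2 : 0 < w ((b : L) * p) := by
    rw [h.mul]; exact lt_of_lt_of_le hpw (le_add_of_nonneg_left (h.intCast b))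
  have := lt_of_lt_of_le (lt_min h1 h2) (h.add _ _)
  rw [hab', h.one] at this
  exact lt_irrefl _ this

theorem gG.mono {m m' : ℤ} {x : L} (h : gG w m x) (hm : m' ≤ m) : gG w m' x :=
  le_trans (by exact_mod_cast hm) h

theorem gE.G {m : ℤ} {x : L} (h : gE w m x) : gG w m x := h.ge

theorem gE.Gle {m m' : ℤ} {x : L} (h : gE w m x) (hm : m' ≤ m) : gG w m' x := h.G.mono hm

theorem gE.le {m m' : ℤ} {x : L} (h : gE w m x) (h' : gG w m' x) : m' ≤ m := by
  unfold gE at h; unfold gG at h'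
  rw [h] at h'
  exact_mod_cast h'

theorem gE.uniq {m m' : ℤ} {x : L} (h : gE w m x) (h' : gE w m' x) : m = m' :=
  le_antisymm (h'.le h.G) (h.le h'.G)

theorem LV.G_add (h : LV w) {m : ℤ} {x y : L} (hx : gG w m x) (hy : gG w m y) : gG w m (x + y) :=
  h.ge_add hx hy

theorem LV.G_neg (h : LV w) {m : ℤ} {x : L} (hx : gG w m x) : gG w m (-x) := by
  unfold gG; rw [h.neg]; exact hx

theorem LV.G_sub (h : LV w) {m : ℤ} {x y : L} (hx : gG w m x) (hy : gG w m y) : gG w m (x - y) := by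
  rw [sub_eq_add_neg]; exact h.G_add hx (h.G_neg hy)

theorem LV.G_mul (h : LV w) {m m' : ℤ} {x y : L} (hx : gG w m x) (hy : gG w m' y) :
    gG w (m + m') (x * y) := by
  unfold gG at *
  rw [h.mul]
  push_cast
  exact add_le_add hx hy

theorem LV.E_mul (h : LV w) {m m' : ℤ} {x y : L} (hx : gE w m x) (hy : gE w m' y) :
    gE w (m + m') (x * y) := by
  unfold gE at *
  rw [h.mul, hx, hy]
  push_cast
  rfl

theorem LV.E_add (h : LV w) {m m' : ℤ} {x y : L} (hx : gE w m x) (hy : gG w m' y) (hm : m < m') :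
    gE w m (x + y) := by
  have h0 : w x < w y := by
    unfold gE at hx; unfold gG at hy
    rw [hx]
    exact lt_of_lt_of_le (by exact_mod_cast hm) hy
  unfold gE
  rw [h.eq_add h0]; exact hx

theorem LV.E_neg (h : LV w) {m : ℤ} {x : L} (hx : gE w m x) : gE w m (-x) := by
  unfold gE; rw [h.neg]; exact hx

theorem LV.G_sum (h : LV w) {m : ℤ} {ι : Type} (s : Finset ι) (f : ι → L)
    (hf : ∀ i ∈ s, gG w m (f i)) : gG w m (∑ i ∈ s, f i) := h.ge_sum s f hf

theorem LV.G_zero (h : LV w) (m : ℤ) : gG w m (0 : L) := by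
  unfold gG; rw [h.zero]; exact le_top

theorem LV.G_intCast (h : LV w) (n : ℤ) : gG w 0 (n : L) := by
  unfold gG; simpa using h.intCast n

theorem LV.E_one (h : LV w) : gE w 0 (1 : L) := by
  unfold gE; simpa using h.one

theorem LV.E_pow (h : LV w) {m : ℤ} {x : L} (hx : gE w m x) (n : ℕ) : gE w (n * m) (x ^ n) := by
  induction n with
  | zero => simpa using h.E_one
  | succ n ih =>
    rw [pow_succ]
    have := h.E_mul ih hx
    rwa [show ((n + 1 : ℕ) : ℤ) * m = n * m + m by push_cast; ring]

theorem LV.E_ne (h : LV w) {m : ℤ} {x : L} (hx : gE w m x) : x ≠ 0 := by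
  rintro rfl
  unfold gE at hx
  rw [h.zero] at hx
  exact absurd hx (by simp)

theorem LV.E_div (h : LV w) {m m' : ℤ} {x y : L} (hx : gE w m x) (hy : gE w m' y) :
    gE w (m - m') (x / y) := by
  have h1 : w (x / y) + w y = w x := by
    rw [← h.mul, div_mul_cancel₀ _ (h.E_ne hy)]
  unfold gE at *
  rw [hx, hy] at h1
  have h2 : w (x / y) ≠ ⊤ := by
    intro h'; rw [h'] at h1; exact absurd h1 (by simp)
  lift w (x / y) to ℚ using h2 with q hq
  norm_cast at h1 ⊢
  push_cast
  linarith

theorem LV.G_div (h : LV w) {m m' : ℤ} {x y : L} (hx : gG w m x) (hy : gE w m' y) :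
    gG w (m - m') (x / y) := by
  have h1 : gE w (-m') (y⁻¹) := by
    have := h.E_div h.E_one hy
    simpa using this
  rw [div_eq_mul_inv, sub_eq_add_neg]
  exact h.G_mul hx h1.G

/-! polynomial operators -/

noncomputable def opD (τ : L →+* L) : Module.End ℤ L := (τ : L →+ L).toIntLinearMap

noncomputable def op (τ : L →+* L) (q : ℤ[X]) (x : L) : L := (aeval (opD τ) q) x

theorem opD_apply (τ : L →+* L) (x : L) : opD τ x = τ x := rfl

theorem op_X (τ : L →+* L) (x : L) : op τ X x = τ x := by simp [op, opD_apply]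
theorem op_add (τ : L →+* L) (a b : ℤ[X]) (x : L) : op τ (a + b) x = op τ a x + op τ b x := by
  simp [op]
theorem op_sub (τ : L →+* L) (a b : ℤ[X]) (x : L) : op τ (a - b) x = op τ a x - op τ b x := by
  simp [op]
theorem op_mul (τ : L →+* L) (a b : ℤ[X]) (x : L) : op τ (a * b) x = op τ a (op τ b x) := by
  simp [op]
theorem op_one (τ : L →+* L) (x : L) : op τ 1 x = x := by simp [op]
theorem op_C (τ : L →+* L) (n : ℤ) (x : L) : op τ (C n) x = n * x := by
  simp [op]
theorem op_Xpow (τ : L →+* L) (i : ℕ) (x : L) : op τ (X ^ i) x = (τ ^ i) x := by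
  induction i generalizing x with
  | zero => simp [op_one]
  | succ i ih => rw [pow_succ, op_mul, ih, op_X, pow_succ]; rfl
theorem op_sum (τ : L →+* L) {ι : Type} (s : Finset ι) (f : ι → ℤ[X]) (x : L) :
    op τ (∑ i ∈ s, f i) x = ∑ i ∈ s, op τ (f i) x := by
  simp [op, LinearMap.sum_apply]
theorem op_arg_add (τ : L →+* L) (a : ℤ[X]) (x y : L) : op τ a (x + y) = op τ a x + op τ a y := by
  simp [op]

theorem LV.G_op (h : LV w) (τ : L →+* L) (hτ : ∀ x, w (τ x) = w x) (q : ℤ[X]) {m : ℤ} {x : L}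
    (hx : gG w m x) : gG w m (op τ q x) := by
  have hpow : ∀ i : ℕ, gG w m ((τ ^ i) x) := by
    intro i
    induction i with
    | zero => simpa using hx
    | succ i ih =>
      rw [pow_succ']
      unfold gG at *
      rw [RingHom.mul_def, RingHom.comp_apply, hτ]; exact ih
  rw [q.as_sum_range_C_mul_X_pow, op_sum]
  apply h.G_sum
  intro i _
  rw [op_mul, op_C, op_Xpow]
  have := h.G_mul (h.G_intCast (q.coeff i)) (hpow i)
  simpa using this

theorem phi_id {p : ℕ} (hp : p.Prime) : ∃ U V : ℤ[X],
    (∑ i ∈ Finset.range p, (X : ℤ[X]) ^ i) = (X - 1) ^ (p - 1) + C (p : ℤ) * U ∧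
      U = 1 + (X - 1) * V := by
  have := Fact.mk hp
  have hmod : (∑ i ∈ Finset.range p, (X : (ZMod p)[X]) ^ i) = (X - 1) ^ (p - 1) := by
    have hne : (X - 1 : (ZMod p)[X]) ≠ 0 := by
      have := X_sub_C_ne_zero (1 : ZMod p)
      simpa using this
    apply mul_right_cancel₀ hne
    rw [geom_sum_mul, ← pow_succ, Nat.sub_add_cancel hp.one_le, sub_pow_char, one_pow]
  have h1 : (C (p : ℤ)) ∣ (∑ i ∈ Finset.range p, (X : ℤ[X]) ^ i) - (X - 1) ^ (p - 1) := by
    rw [Polynomial.C_dvd_iff_dvd_coeff]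
    intro i
    rw [← ZMod.intCast_zmod_eq_zero_iff_dvd]
    have h2 : ((∑ i ∈ Finset.range p, (X : ℤ[X]) ^ i) - (X - 1) ^ (p - 1)).map
        (Int.castRingHom (ZMod p)) = 0 := by
      simp [Polynomial.map_sum, Polynomial.map_sub, hmod]
    have h3 := congrArg (fun q => q.coeff i) h2
    simp only [coeff_map, coeff_zero] at h3
    exact h3
  obtain ⟨U, hU⟩ := h1
  have hid : (∑ i ∈ Finset.range p, (X : ℤ[X]) ^ i) = (X - 1) ^ (p - 1) + C (p : ℤ) * U := by
    rw [← hU]; ring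
  have hev : U.eval 1 = 1 := by
    have h4 := congrArg (eval 1) hid
    have hp1 : p - 1 ≠ 0 := by have := hp.two_le; omega
    simp [eval_finsetSum, hp1] at h4
    have : (p : ℤ) ≠ 0 := by exact_mod_cast hp.ne_zero
    have h5 : (p : ℤ) * (U.eval 1 - 1) = 0 := by linarith
    rcases mul_eq_zero.1 h5 with h | h
    · exact absurd h this
    · linarith
  have h6 : (X - C (1 : ℤ)) ∣ U - 1 := by
    rw [dvd_iff_isRoot]; simp [hev]
  obtain ⟨V, hV⟩ := h6
  refine ⟨U, V, hid, ?_⟩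
  rw [C_1] at hV
  rw [← hV]; ring

end basics

section level
open Polynomial

def TT (p : ℕ) : ℕ → ℤ
  | 0 => 1
  | (j + 1) => p * TT p j + 1

theorem TT_mul (p : ℕ) (j : ℕ) : ((p : ℤ) - 1) * TT p j = (p : ℤ) ^ (j + 1) - 1 := by
  induction j with
  | zero => simp [TT]
  | succ j ih => rw [TT, mul_add, mul_left_comm, ih]; ring

theorem TT_succ (p : ℕ) (j : ℕ) : TT p (j + 1) = TT p j + (p : ℤ) ^ (j + 1) := by
  have := TT_mul p j
  rw [TT]; linarith

theorem TT_pos (p : ℕ) (j : ℕ) : 1 ≤ TT p j := by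
  induction j with
  | zero => simp [TT]
  | succ j ih => rw [TT_succ]; have : (0:ℤ) ≤ (p : ℤ) ^ (j + 1) := by positivity
                 linarith

variable {L : Type} [Field L] {w : L → WithTop ℚ} {p k : ℕ} {τ σ : L →+* L} {π : L} {t : ℤ}

structure Gain (p : ℕ) (w : L → WithTop ℚ) (τ : L →+* L) (t : ℤ) : Prop where
  g0 : ∀ m : ℤ, 0 ≤ m → ∀ x, gG w m x → gG w (m + t) (τ x - x)
  g1 : ∀ m : ℤ, 0 ≤ m → (p : ℤ) ∣ m → ∀ x, gG w m x → gG w (m + t + 1) (τ x - x)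
  ge : ∀ m : ℤ, 0 ≤ m → ¬ (p : ℤ) ∣ m → ∀ x, gE w m x → gE w (m + t) (τ x - x)

/-- single automorphism data -/
structure Pre (p k : ℕ) (w : L → WithTop ℚ) (τ : L →+* L) (π : L) : Prop where
  val : LV w
  prime : p.Prime
  wp : gE w ((p : ℤ) ^ k) (p : L)
  inv : ∀ x, w (τ x) = w x
  unif : gE w 1 π
  int : ∀ x, x ≠ 0 → ∃ m : ℤ, gE w m x
  res : ∀ x, gG w 0 x → ∃ a, τ a = a ∧ gG w 1 (x - a)

theorem Pre.wp1 (h : Pre p k w τ π) : gG w 1 (p : L) :=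
  h.wp.Gle (by have := h.prime.pos; exact_mod_cast Nat.one_le_pow _ _ this)

theorem Pre.wp0 (h : Pre p k w τ π) : 0 < w (p : L) := by
  have := h.wp1
  unfold gG at this
  exact lt_of_lt_of_le (by norm_num) this

theorem Pre.invG (h : Pre p k w τ π) {m : ℤ} {x : L} : gG w m (τ x) ↔ gG w m x := by
  unfold gG; rw [h.inv]

theorem Pre.up (h : Pre p k w τ π) {m : ℤ} {x : L} (hx : gG w m x) (hn : ¬ gE w m x) :
    gG w (m + 1) x := by
  by_cases h0 : x = 0
  · rw [h0]; exact h.val.G_zero _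
  obtain ⟨m', hm'⟩ := h.int x h0
  have h1 := hm'.le hx
  have h2 : m ≠ m' := by rintro rfl; exact hn hm'
  exact hm'.Gle (by omega)

theorem Pre.mono (h : Pre p k w τ π) (ht : 1 ≤ t) (hπ : gE w (1 + t) (τ π - π)) (m : ℕ) :
    ∃ s z : L, τ (π ^ m) - π ^ m = π ^ m * (s * z) ∧ gE w t z ∧ gG w 0 s ∧
      ((p : ℤ) ∣ m → gG w 1 s) ∧ (¬ (p : ℤ) ∣ m → gE w 0 s) := by
  have hπ0 : π ≠ 0 := h.val.E_ne h.unif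
  set z := (τ π - π) / π with hz
  have hzE : gE w t z := by
    have := h.val.E_div hπ h.unif
    rwa [show 1 + t - 1 = t by ring] at this
  have hτ : τ π = π * (1 + z) := by rw [hz]; field_simp; ring
  have h1z : gG w 0 (1 + z) := h.val.G_add h.val.E_one.G (hzE.Gle (by omega))
  have hpow : ∀ i : ℕ, gG w 0 ((1 + z) ^ i) := by
    intro i
    induction i with
    | zero => simpa using h.val.E_one.G
    | succ i ih => rw [pow_succ]; simpa using h.val.G_mul ih h1z
  have hs0 : ∀ m : ℕ, gG w 0 (∑ i ∈ Finset.range m, (1 + z) ^ i) := fun m =>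
    h.val.G_sum _ _ fun i _ => hpow i
  have hgeom : ∀ m : ℕ, (∑ i ∈ Finset.range m, (1 + z) ^ i) * z = (1 + z) ^ m - 1 := by
    intro m
    have := geom_sum_mul (1 + z) m
    rwa [add_sub_cancel_left] at this
  have hrest : gG w 1 (∑ i ∈ Finset.range m, ((1 + z) ^ i - 1)) := by
    apply h.val.G_sum
    intro i _
    rw [← hgeom]
    have := h.val.G_mul (hs0 i) hzE.G
    exact this.mono (by omega)
  have hs : (∑ i ∈ Finset.range m, (1 + z) ^ i) = m + ∑ i ∈ Finset.range m, ((1 + z) ^ i - 1) := by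
    simp
  refine ⟨∑ i ∈ Finset.range m, (1 + z) ^ i, z, ?_, hzE, hs0 m, ?_, ?_⟩
  · rw [hgeom, map_pow, hτ, mul_pow]; ring
  · intro hd
    rw [hs]
    apply h.val.G_add _ hrest
    obtain ⟨c, hc⟩ := Int.natCast_dvd_natCast.1 hd
    rw [hc]; push_cast
    have := h.val.G_mul h.wp1 (h.val.G_intCast c)
    simpa using this
  · intro hd
    rw [hs]
    apply h.val.E_add (m' := 1) _ hrest (by norm_num)
    unfold gE
    rw [h.val.natCast_coprime h.prime h.wp0 (fun h' => hd (Int.natCast_dvd_natCast.2 h'))]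
    simp

theorem Pre.decomp (h : Pre p k w τ π) (m : ℕ) {x : L} (hx : gG w m x) :
    ∃ a x1, τ a = a ∧ gG w 0 a ∧ gG w (m + 1) x1 ∧ x = a * π ^ m + x1 := by
  have hpm : gE w m (π ^ m) := by simpa using h.val.E_pow h.unif m
  have h0 := h.val.G_div hx hpm
  rw [sub_self] at h0
  obtain ⟨a, ha, hxa⟩ := h.res _ h0
  refine ⟨a, (x / π ^ m - a) * π ^ m, ha, ?_, ?_, ?_⟩
  · have := h.val.G_sub h0 (hxa.mono (by norm_num))
    simpa using this
  · have := h.val.G_mul hxa hpm.G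
    rwa [add_comm] at this
  · have := h.val.E_ne hpm
    field_simp
    ring_nf

theorem Pre.gain (h : Pre p k w τ π) (ht : 1 ≤ t) (hπ : gE w (1 + t) (τ π - π)) :
    Gain p w τ t := by
  have hpm : ∀ m : ℕ, gE w m (π ^ m) := fun m => by simpa using h.val.E_pow h.unif m
  have key : ∀ (d : ℕ) (m : ℕ) (x : L), gG w m x → gG w (m + min t d) (τ x - x) := by
    intro d
    induction d with
    | zero =>
      intro m x hx
      have := h.val.G_sub (h.invG.2 hx) hx
      exact this.mono (by simp)
    | succ d ih =>
      intro m x hx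
      obtain ⟨a, x1, ha, ha0, hx1, rfl⟩ := h.decomp m hx
      obtain ⟨s, z, hsz, hz, hs, -, -⟩ := h.mono ht hπ m
      have e : τ (a * π ^ m + x1) - (a * π ^ m + x1)
          = a * (π ^ m * (s * z)) + (τ x1 - x1) := by
        rw [← hsz, map_add, map_mul, ha]; ring
      rw [e]
      apply h.val.G_add
      · have := h.val.G_mul ha0 (h.val.G_mul (hpm m).G (h.val.G_mul hs hz.G))
        exact this.mono (by simp)
      · have := ih (m + 1) x1 (by exact_mod_cast hx1)
        exact this.mono (by push_cast; omega)
  have key0 : ∀ (m : ℕ) (x : L), gG w m x → gG w (m + t) (τ x - x) := by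
    intro m x hx
    exact (key t.toNat m x hx).mono (by omega)
  refine ⟨?_, ?_, ?_⟩
  · intro m hm x hx
    lift m to ℕ using hm
    exact key0 m x hx
  · intro m hm hd x hx
    lift m to ℕ using hm
    obtain ⟨a, x1, ha, ha0, hx1, rfl⟩ := h.decomp m hx
    obtain ⟨s, z, hsz, hz, hs, hs1, -⟩ := h.mono ht hπ m
    have e : τ (a * π ^ m + x1) - (a * π ^ m + x1)
        = a * (π ^ m * (s * z)) + (τ x1 - x1) := by
      rw [← hsz, map_add, map_mul, ha]; ring
    rw [e]
    apply h.val.G_add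
    · have := h.val.G_mul ha0 (h.val.G_mul (hpm m).G (h.val.G_mul (hs1 hd) hz.G))
      exact this.mono (by omega)
    · exact (key0 (m + 1) x1 (by exact_mod_cast hx1)).mono (by push_cast; omega)
  · intro m hm hd x hx
    lift m to ℕ using hm
    obtain ⟨a, x1, ha, ha0, hx1, rfl⟩ := h.decomp m hx.G
    obtain ⟨s, z, hsz, hz, hs, -, hs1⟩ := h.mono ht hπ m
    have e : τ (a * π ^ m + x1) - (a * π ^ m + x1)
        = a * (π ^ m * (s * z)) + (τ x1 - x1) := by
      rw [← hsz, map_add, map_mul, ha]; ring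
    rw [e]
    have haE : gE w 0 a := by
      have h1 := h.val.E_add hx (h.val.G_neg hx1) (by omega)
      rw [add_neg_cancel_right] at h1
      have h2 := h.val.E_div h1 (hpm m)
      rwa [mul_div_cancel_right₀ _ (h.val.E_ne (hpm m)), sub_self] at h2
    have h3 := h.val.E_mul haE (h.val.E_mul (hpm m) (h.val.E_mul (hs1 hd) hz))
    rw [show (0 : ℤ) + (m + (0 + t)) = m + t by ring] at h3
    exact h.val.E_add h3 (key0 (m + 1) x1 (by exact_mod_cast hx1)) (by push_cast; omega)

theorem Pre.wild (h : Pre p k w τ π) (q : ℕ) (hq : τ ^ (p ^ q) = 1) : gG w 2 (τ π - π) := by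
  have hπ0 : π ≠ 0 := h.val.E_ne h.unif
  have hτπ : gE w 1 (τ π) := by unfold gE; rw [h.inv]; exact h.unif
  have hx0 : gE w 0 (τ π / π) := by simpa using h.val.E_div hτπ h.unif
  obtain ⟨a, ha, hxa⟩ := h.res _ hx0.G
  have ha0 : gG w 0 a := by
    have := h.val.G_sub hx0.G (hxa.mono (by norm_num))
    simpa using this
  have hai : ∀ i : ℕ, gG w 0 (a ^ i) := by
    intro i
    induction i with
    | zero => simpa using h.val.E_one.G
    | succ i ih => rw [pow_succ]; simpa using h.val.G_mul ih ha0
  have hcong : ∀ i : ℕ, gG w 1 ((τ ^ i) π / π - a ^ i) := by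
    intro i
    induction i with
    | zero => simpa [hπ0] using h.val.G_zero 1
    | succ i ih =>
      have e : (τ ^ (i + 1)) π / π - a ^ (i + 1)
          = τ ((τ ^ i) π / π - a ^ i) * (τ π / π) + a ^ i * (τ π / π - a) := by
        have h2 : τ π ≠ 0 := h.val.E_ne hτπ
        rw [pow_succ', RingHom.mul_def, RingHom.comp_apply, map_sub, map_div₀, map_pow, ha]
        field_simp; ring
      rw [e]
      apply h.val.G_add
      · simpa using h.val.G_mul (h.invG.2 ih) hx0.G
      · simpa using h.val.G_mul (hai i) hxa
  have h1 : gG w 1 (1 - a ^ (p ^ q)) := by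
    have := hcong (p ^ q)
    rw [hq] at this
    simpa [hπ0] using this
  have := Fact.mk h.prime
  obtain ⟨r, hr⟩ := exists_add_pow_prime_pow_eq h.prime (X : ℤ[X]) 1 q
  have hr' := congrArg (aeval (a - 1)) hr
  simp only [map_pow, map_add, aeval_X, map_one, map_mul, map_natCast, one_pow,
    sub_add_cancel, mul_one] at hr'
  have hb0 : gG w 0 (a - 1) := h.val.G_sub ha0 h.val.E_one.G
  have hbi : ∀ i : ℕ, gG w 0 ((a - 1) ^ i) := by
    intro i
    induction i with
    | zero => simpa using h.val.E_one.G
    | succ i ih => rw [pow_succ]; simpa using h.val.G_mul ih hb0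
  have hrb : gG w 0 (aeval (a - 1) r) := by
    rw [aeval_eq_sum_range]
    apply h.val.G_sum
    intro i _
    rw [zsmul_eq_mul]
    simpa using h.val.G_mul (h.val.G_intCast (r.coeff i)) (hbi i)
  have h2 : gG w 1 ((a - 1) ^ (p ^ q)) := by
    have e : (a - 1) ^ (p ^ q) = -(1 - a ^ (p ^ q)) - (p * ((a - 1) * aeval (a - 1) r)) := by
      rw [hr']; ring
    rw [e]
    apply h.val.G_sub (h.val.G_neg h1)
    simpa using h.val.G_mul h.wp1 (h.val.G_mul hb0 hrb)
  have hb1 : gG w 1 (a - 1) := by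
    by_contra hc
    have h3 : gE w 0 (a - 1) := by
      by_contra h4
      exact hc (by simpa using h.up hb0 h4)
    have h5 := h.val.E_pow h3 (p ^ q)
    have := h5.le h2
    simp at this
  have h4 : gG w 1 (τ π / π - 1) := by
    have := h.val.G_add hxa hb1
    rwa [sub_add_sub_cancel] at this
  have h5 := h.val.G_mul h4 h.unif.G
  rwa [sub_mul, div_mul_cancel₀ _ hπ0, one_mul] at h5

end level

section brk
open Polynomial
variable {L : Type} [Field L] {w : L → WithTop ℚ} {p k : ℕ} {τ τ' σ : L →+* L} {π : L} {t t' : ℤ}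

noncomputable abbrev NN (τ : L →+* L) (i : ℕ) (x : L) : L := op τ ((X - 1) ^ i) x

theorem NN_zero (x : L) : NN τ 0 x = x := by simp [NN, op_one]
theorem NN_one (x : L) : NN τ 1 x = τ x - x := by simp [NN, op_sub, op_X, op_one]
theorem NN_succ (i : ℕ) (x : L) : NN τ (i + 1) x = τ (NN τ i x) - NN τ i x := by
  rw [NN, pow_succ', op_mul, op_sub, op_X, op_one]
theorem NN_add (i j : ℕ) (x : L) : NN τ (i + j) x = NN τ i (NN τ j x) := by
  rw [NN, pow_add, op_mul]

theorem Gain.N0 (g : Gain p w τ t) (ht : 1 ≤ t) {m : ℤ} (hm : 0 ≤ m) {x : L} (hx : gG w m x)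
    (i : ℕ) : gG w (m + i * t) (NN τ i x) := by
  induction i with
  | zero => simpa [NN_zero] using hx
  | succ i ih =>
    rw [NN_succ]
    have := g.g0 (m + i * t) (by positivity) _ ih
    exact this.mono (by push_cast; linarith)

theorem Gain.N1 (g : Gain p w τ t) (ht : 1 ≤ t) {m : ℤ} (hm : 0 ≤ m) (hd : (p : ℤ) ∣ m) {x : L}
    (hx : gG w m x) (i : ℕ) (hi : 1 ≤ i) : gG w (m + i * t + 1) (NN τ i x) := by
  obtain ⟨j, rfl⟩ := Nat.exists_eq_add_of_le hi
  rw [add_comm 1 j, NN_add, NN_one]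
  have h1 := g.g1 m hm hd x hx
  have := g.N0 ht (by omega) h1 j
  exact this.mono (by push_cast; linarith)

theorem Gain.NE (g : Gain p w τ t) (ht : 1 ≤ t) (hpt : (p : ℤ) ∣ t) {m : ℤ} (hm : 0 ≤ m)
    (hd : ¬ (p : ℤ) ∣ m) {x : L} (hx : gE w m x) (i : ℕ) : gE w (m + i * t) (NN τ i x) := by
  induction i with
  | zero => simpa [NN_zero] using hx
  | succ i ih =>
    rw [NN_succ]
    have := g.ge (m + i * t) (by positivity)
      (fun h => hd ((Int.dvd_iff_dvd_of_dvd_add h).2 (hpt.mul_left _))) _ ih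
    rwa [show m + ((i + 1 : ℕ) : ℤ) * t = m + i * t + t by push_cast; ring]

theorem Gain.NE1 (g : Gain p w τ t) (ht : 1 ≤ t) (hpt : (p : ℤ) ∣ t - 1) {m : ℤ} (hm : 0 ≤ m)
    (hd : (p : ℤ) ∣ m - 1) {x : L} (hx : gE w m x) (i : ℕ) (hi : i < p) :
    gE w (m + i * t) (NN τ i x) := by
  induction i with
  | zero => simpa [NN_zero] using hx
  | succ i ih =>
    rw [NN_succ]
    have := g.ge (m + i * t) (by positivity) ?_ _ (ih (by omega))
    · rwa [show m + ((i + 1 : ℕ) : ℤ) * t = m + i * t + t by push_cast; ring]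
    · intro h
      have h2 : (p : ℤ) ∣ (i + 1 : ℕ) := by
        have h3 : (p : ℤ) ∣ (m - 1) + i * (t - 1) := dvd_add hd (hpt.mul_left _)
        have h4 := dvd_sub h h3
        have e : m + i * t - (m - 1 + i * (t - 1)) = ((i + 1 : ℕ) : ℤ) := by push_cast; ring
        rwa [e] at h4
      have h5 := Nat.le_of_dvd (by omega) (Int.natCast_dvd_natCast.1 h2)
      omega

theorem Gain.Nhit (g : Gain p w τ t) (hp : p.Prime) (ht : 1 ≤ t) (hpt : ¬ (p : ℤ) ∣ t) {m : ℤ}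
    (hm : 0 ≤ m) {x : L} (hx : gG w m x) : gG w (m + p * t + 1) (NN τ p x) := by
  have hex : ∃ i : ℕ, i < p ∧ (p : ℤ) ∣ m + i * t := by
    have hpp : Prime (p : ℤ) := Nat.prime_iff_prime_int.1 hp
    have hc : IsCoprime t (p : ℤ) := ((Prime.coprime_iff_not_dvd hpp).2 hpt).symm
    obtain ⟨a, b, hab⟩ := hc
    have hp0 : (0 : ℤ) < p := by exact_mod_cast hp.pos
    refine ⟨((-m * a) % p).toNat, ?_, ?_⟩
    · have h1 := Int.emod_lt_of_pos (-m * a) hp0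
      have h2 := Int.emod_nonneg (-m * a) hp0.ne'
      omega
    · rw [Int.toNat_of_nonneg (Int.emod_nonneg _ hp0.ne')]
      have h3 := Int.emod_add_mul_ediv (-m * a) p
      have e : m + (-m * a) % p * t = p * (m * b - (-m * a) / p * t) := by
        have e1 : (-m * a) % p = -m * a - p * ((-m * a) / p) := by linarith
        rw [e1]
        linear_combination (-m) * hab
      rw [e]; exact dvd_mul_right _ _
  obtain ⟨i, hi, hd⟩ := hex
  have e : NN τ p x = NN τ (p - i) (NN τ i x) := by
    rw [← NN_add, Nat.sub_add_cancel hi.le]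
  rw [e]
  have := g.N1 ht (by positivity) hd (g.N0 ht hm hx i) (p - i) (by omega)
  refine this.mono (le_of_eq ?_)
  rw [Nat.cast_sub hi.le]; ring

/-- τ^p - 1 = N^p + p U N -/
theorem powp_id (hp : p.Prime) (τ : L →+* L) : ∃ U V : ℤ[X],
    (∑ i ∈ Finset.range p, (X : ℤ[X]) ^ i) = (X - 1) ^ (p - 1) + C (p : ℤ) * U ∧
      U = 1 + (X - 1) * V ∧
    (∀ x, (∑ i ∈ Finset.range p, (τ ^ i) x) = NN τ (p - 1) x + p * op τ U x) ∧
    (∀ x, (τ ^ p) x - x = NN τ p x + p * op τ U (τ x - x)) := by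
  obtain ⟨U, V, h1, h2⟩ := phi_id hp
  refine ⟨U, V, h1, h2, ?_, ?_⟩
  · intro x
    have := congrArg (fun q => op τ q x) h1
    simp only [op_sum, op_Xpow, op_add, op_mul, op_C] at this
    simpa using this
  · intro x
    have h3 : (X : ℤ[X]) ^ p - 1 = (X - 1) ^ p + C (p : ℤ) * (U * (X - 1)) := by
      rw [← geom_sum_mul, h1]
      have : ((X : ℤ[X]) - 1) ^ p = (X - 1) ^ (p - 1) * (X - 1) := by
        rw [← pow_succ, Nat.sub_add_cancel hp.one_le]
      rw [this]; ring
    have := congrArg (fun q => op τ q x) h3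
    simp only [op_sub, op_Xpow, op_add, op_mul, op_C, op_one, op_X] at this
    simpa using this

theorem Gain.UE (g : Gain p w τ t) (h : LV w) (hinv : ∀ x, w (τ x) = w x) (ht : 1 ≤ t)
    {U V : ℤ[X]} (hU : U = 1 + (X - 1) * V) {m : ℤ} (hm : 0 ≤ m) {x : L} (hx : gE w m x) :
    gE w m (op τ U x) := by
  rw [hU, op_add, op_one, op_mul, op_sub, op_X, op_one]
  exact h.E_add hx (g.g0 m hm _ (h.G_op τ hinv V hx.G)) (by omega)

theorem Pre.top (h : Pre p k w τ π) (hodd : Odd p) (g : Gain p w τ t) (ht : 1 ≤ t)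
    (hτ : τ ^ p = 1) : ¬ (p : ℤ) ∣ t ∧ ((p : ℤ) - 1) * t + 1 ≤ (p : ℤ) ^ k := by
  have hp := h.prime
  have hp3 : 3 ≤ p := by
    have := hp.two_le
    obtain ⟨c, hc⟩ := hodd
    omega
  have hnd1 : ¬ (p : ℤ) ∣ 1 := fun hd => by
    have := Int.le_of_dvd (by norm_num) hd
    omega
  obtain ⟨U, V, -, hU, -, hid⟩ := powp_id hp τ
  have h1 := hid π
  rw [hτ] at h1
  have hE1 : gE w (1 + t) (τ π - π) := g.ge 1 (by norm_num) hnd1 π h.unif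
  have hE2 := g.UE h.val h.inv ht hU (by omega) hE1
  have hE3 := h.val.E_mul h.wp hE2
  have hE4 : gE w ((p : ℤ) ^ k + (1 + t)) (NN τ p π) := by
    have e : NN τ p π = -(p * op τ U (τ π - π)) := by
      have : (1 : L →+* L) π - π = 0 := by simp
      rw [this] at h1
      linear_combination -h1
    rw [e]; exact h.val.E_neg hE3
  have hnd : ¬ (p : ℤ) ∣ t := by
    intro hd
    have := g.NE ht hd (by norm_num) hnd1 h.unif p
    have h5 := this.uniq hE4
    have h6 : ((p : ℤ) - 1) * t = p ^ k := by linarith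
    have h7 : (p - 1) ∣ p ^ k := by
      have : ((p - 1 : ℕ) : ℤ) ∣ ((p ^ k : ℕ) : ℤ) := by
        rw [Nat.cast_sub hp.one_le]; push_cast
        exact ⟨t, h6.symm⟩
      exact Int.natCast_dvd_natCast.1 this
    have h8 : Nat.Coprime (p - 1) (p ^ k) := by
      apply Nat.Coprime.pow_right
      have := Nat.coprime_self_sub_right (m := 1) (n := p) hp.one_le
      rw [Nat.coprime_comm]
      rw [this]; simp
    have h9 := Nat.Coprime.eq_one_of_dvd h8 h7
    omega
  refine ⟨hnd, ?_⟩
  have := hE4.le (g.Nhit hp ht hnd (by norm_num) h.unif.G)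
  linarith

theorem Pre.step (h : Pre p k w τ π) (g : Gain p w τ t) (ht : 1 ≤ t) (g' : Gain p w (τ ^ p) t')
    (hpt : ¬ (p : ℤ) ∣ t) : min (p * t + 1) ((p : ℤ) ^ k + t) ≤ t' := by
  have hp := h.prime
  have hnd1 : ¬ (p : ℤ) ∣ 1 := fun hd => by
    have := Int.le_of_dvd (by norm_num) hd
    have := hp.two_le
    omega
  obtain ⟨U, V, -, hU, -, hid⟩ := powp_id hp τ
  have h1 := g'.ge 1 (by norm_num) hnd1 π h.unif
  have h2 : gG w (1 + min (p * t + 1) ((p : ℤ) ^ k + t)) ((τ ^ p) π - π) := by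
    rw [hid]
    apply h.val.G_add
    · exact (g.Nhit hp ht hpt (by norm_num) h.unif.G).mono (by omega)
    · have := h.val.G_mul h.wp.G (h.val.G_op τ h.inv U (g.g0 1 (by norm_num) π h.unif.G))
      exact this.mono (by omega)
  have := h1.le h2
  omega

theorem Pre.copr (h : Pre p k w τ π) (g : Gain p w τ t) (ht : 1 ≤ t) (g' : Gain p w τ' t')
    (ht' : 1 ≤ t') (hc : ∀ x, τ (τ' x) = τ' (τ x)) (hpt' : ¬ (p : ℤ) ∣ t') : ¬ (p : ℤ) ∣ t := by
  intro hpt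
  have hp := h.prime
  have hp0 : (0 : ℤ) < p := by exact_mod_cast hp.pos
  obtain ⟨v, hv⟩ : ∃ v : ℕ, (p : ℤ) ∣ v + t' := by
    refine ⟨((p - 1) * t').toNat, ?_⟩
    rw [Int.toNat_of_nonneg (by apply mul_nonneg <;> omega)]
    exact ⟨t', by ring⟩
  have hvd : ¬ (p : ℤ) ∣ v := fun hd => hpt' ((Int.dvd_iff_dvd_of_dvd_add hv).1 hd)
  have hx : gE w v (π ^ v) := by simpa using h.val.E_pow h.unif v
  set x := π ^ v
  have h1 := g'.ge v (by omega) hvd x hx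
  have h2 := g.g1 _ (by omega) hv _ h1.G
  have h3 := g.ge v (by omega) hvd x hx
  have h4 := g'.ge _ (by omega) (fun hd => hvd ((Int.dvd_iff_dvd_of_dvd_add hd).2 hpt)) _ h3
  have e : τ (τ' x - x) - (τ' x - x) = τ' (τ x - x) - (τ x - x) := by
    rw [map_sub, map_sub, hc]; ring
  rw [e] at h2
  have := h4.le h2
  omega

structure Lev (p k : ℕ) (w : L → WithTop ℚ) (σ : L →+* L) (π : L) : Prop where
  pre : Pre p k w σ π
  odd : Odd p
  ord : σ ^ (p ^ k) = 1
  prim : 1 ≤ k → (σ ^ (p ^ (k - 1))) π ≠ π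

theorem pow_fix (a : L) (ha : σ a = a) (i : ℕ) : (σ ^ i) a = a := by
  induction i with
  | zero => simp
  | succ i ih => rw [pow_succ, RingHom.mul_def, RingHom.comp_apply, ha, ih]

theorem Pre.pow (h : Pre p k w σ π) (i : ℕ) : Pre p k w (σ ^ i) π where
  val := h.val
  prime := h.prime
  wp := h.wp
  inv := by
    induction i with
    | zero => intro x; simp
    | succ i ih => intro x; rw [pow_succ, RingHom.mul_def, RingHom.comp_apply, ih, h.inv]
  unif := h.unif
  int := h.int
  res := by
    intro x hx
    obtain ⟨a, ha, hxa⟩ := h.res x hx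
    exact ⟨a, pow_fix a ha i, hxa⟩

theorem Lev.gain (h : Lev p k w σ π) (j : ℕ) (hj : j < k) : Gain p w (σ ^ (p ^ j)) (TT p j) := by
  have hp := h.pre.prime
  have hp2 : (2 : ℤ) ≤ p := by exact_mod_cast hp.two_le
  have hex : ∀ j, ∃ t : ℤ, j < k → 1 ≤ t ∧ Gain p w (σ ^ (p ^ j)) t := by
    intro j
    by_cases hj : j < k
    swap
    · exact ⟨0, fun h' => absurd h' hj⟩
    have hP := h.pre.pow (p ^ j)
    have hne : (σ ^ (p ^ j)) π - π ≠ 0 := by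
      intro h0
      have h1 := pow_fix π (sub_eq_zero.1 h0) (p ^ (k - 1 - j))
      rw [← pow_mul, ← pow_add, show j + (k - 1 - j) = k - 1 by omega] at h1
      exact h.prim (by omega) h1
    obtain ⟨m, hm⟩ := h.pre.int _ hne
    have hw := hP.wild k (by
      rw [← pow_mul, mul_comm, pow_mul, h.ord, one_pow])
    have h2 := hm.le hw
    refine ⟨m - 1, fun _ => ⟨by omega, hP.gain (by omega) ?_⟩⟩
    rwa [show 1 + (m - 1) = m by ring]
  choose t ht using hex
  obtain ⟨K, rfl⟩ : ∃ K, k = K + 1 := ⟨k - 1, by omega⟩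
  have htop := (h.pre.pow (p ^ K)).top h.odd (ht K (by omega)).2 (ht K (by omega)).1
    (by rw [← pow_mul, ← pow_succ]; exact h.ord)
  have hnd : ∀ j, j < K + 1 → ¬ (p : ℤ) ∣ t j := by
    intro j hj
    refine (h.pre.pow (p ^ j)).copr (ht j hj).2 (ht j hj).1 (ht K (by omega)).2 (ht K (by omega)).1
      ?_ htop.1
    intro x
    change (σ ^ (p ^ j) * σ ^ (p ^ K)) x = (σ ^ (p ^ K) * σ ^ (p ^ j)) x
    rw [← pow_add, ← pow_add, add_comm]
  have hstep : ∀ j, j + 1 < K + 1 → min (p * t j + 1) ((p : ℤ) ^ (K + 1) + t j) ≤ t (j + 1) := by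
    intro j hj
    have g' := (ht (j + 1) hj).2
    rw [pow_succ, pow_mul] at g'
    exact (h.pre.pow (p ^ j)).step (ht j (by omega)).2 (ht j (by omega)).1 g' (hnd j (by omega))
  have hpw : ∀ j, j < K + 1 → (p : ℤ) ^ (j + 1) ≤ (p : ℤ) ^ (K + 1) := fun j hj =>
    pow_le_pow_right₀ (by omega) (by omega)
  have hlow : ∀ j, j < K + 1 → TT p j ≤ t j := by
    intro j
    induction j with
    | zero => intro hj; simpa [TT] using (ht 0 hj).1
    | succ j ih =>
      intro hj
      have h1 := ih (by omega)
      refine le_trans (le_min ?_ ?_) (hstep j hj)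
      · rw [TT]; nlinarith
      · rw [TT_succ]; linarith [hpw j (by omega)]
  have htopeq : t K ≤ TT p K := by
    have h1 := TT_mul p K
    have h2 := htop.2
    nlinarith
  have hup : ∀ d, d ≤ K → t (K - d) ≤ TT p (K - d) := by
    intro d
    induction d with
    | zero => intro _; simpa using htopeq
    | succ d ih =>
      intro hd
      by_contra hc
      push Not at hc
      have h1 := ih (by omega)
      have h2 := hstep (K - (d + 1)) (by omega)
      rw [show K - (d + 1) + 1 = K - d by omega] at h2
      have h3 : TT p (K - d) + 1 ≤ t (K - d) := by
        refine le_trans (le_min ?_ ?_) h2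
        · rw [show K - d = K - (d + 1) + 1 by omega, TT]; nlinarith
        · rw [show K - d = K - (d + 1) + 1 by omega, TT_succ]
          linarith [hpw (K - (d + 1)) (by omega)]
      omega
  have h1 := hup (K - j) (by omega)
  rw [show K - (K - j) = j by omega] at h1
  have h2 := le_antisymm h1 (hlow j hj)
  rw [← h2]
  exact (ht j hj).2

end brk

section phis
open Polynomial
variable {L : Type} [Field L] {w : L → WithTop ℚ} {p k : ℕ} {τ σ : L →+* L} {π : L} {t : ℤ}

noncomputable def Phi (p : ℕ) (τ : L →+* L) (x : L) : L := ∑ i ∈ Finset.range p, (τ ^ i) x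

theorem sum_blocks {M : Type} [AddCommMonoid M] (f : ℕ → M) (N a : ℕ) :
    ∑ i ∈ Finset.range (N * a), f i
      = ∑ c ∈ Finset.range a, ∑ b ∈ Finset.range N, f (N * c + b) := by
  induction a with
  | zero => simp
  | succ a ih => rw [Nat.mul_succ, Finset.sum_range_add, ih, Finset.sum_range_succ]

theorem Phi_sum (σ : L →+* L) (N q : ℕ) (x : L) :
    Phi p (σ ^ (q * N)) (∑ i ∈ Finset.range N, (σ ^ (q * i)) x)
      = ∑ i ∈ Finset.range (N * p), (σ ^ (q * i)) x := by
  rw [sum_blocks, Phi]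
  apply Finset.sum_congr rfl
  intro c _
  rw [map_sum]
  apply Finset.sum_congr rfl
  intro b _
  rw [← RingHom.comp_apply, ← RingHom.mul_def, ← pow_mul, ← pow_add]
  congr 2
  ring

theorem Lev.p3 (h : Lev p k w σ π) : (3 : ℤ) ≤ p := by
  have := h.pre.prime.two_le
  obtain ⟨c, hc⟩ := h.odd
  omega

theorem Lev.pw (h : Lev p k w σ π) {j : ℕ} (hj : j < k) : (p : ℤ) ^ (j + 1) ≤ (p : ℤ) ^ k :=
  pow_le_pow_right₀ (by have := h.p3; omega) (by omega)

theorem Lev.phi0 (h : Lev p k w σ π) {j : ℕ} (hj : j < k) {m : ℤ} (hm : 0 ≤ m) {x : L}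
    (hx : gG w m x) : gG w (m + (p : ℤ) ^ (j + 1) - 1) (Phi p (σ ^ (p ^ j)) x) := by
  obtain ⟨U, V, -, -, hid, -⟩ := powp_id h.pre.prime (σ ^ (p ^ j))
  rw [Phi, hid]
  have g := h.gain j hj
  apply h.pre.val.G_add
  · have := g.N0 (TT_pos p j) hm hx (p - 1)
    rw [Nat.cast_sub h.pre.prime.one_le, Nat.cast_one, TT_mul] at this
    exact this.mono (by linarith)
  · have := h.pre.val.G_mul h.pre.wp.G (h.pre.val.G_op _ (h.pre.pow (p ^ j)).inv U hx)
    exact this.mono (by linarith [h.pw hj])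

theorem Lev.phi1 (h : Lev p k w σ π) {j : ℕ} (hj : j < k) {m : ℤ} (hm : 0 ≤ m)
    (hd : (p : ℤ) ∣ m) {x : L}
    (hx : gG w m x) : gG w (m + (p : ℤ) ^ (j + 1)) (Phi p (σ ^ (p ^ j)) x) := by
  obtain ⟨U, V, -, -, hid, -⟩ := powp_id h.pre.prime (σ ^ (p ^ j))
  rw [Phi, hid]
  have g := h.gain j hj
  apply h.pre.val.G_add
  · have := g.N1 (TT_pos p j) hm hd hx (p - 1) (by have := h.p3; omega)
    rw [Nat.cast_sub h.pre.prime.one_le, Nat.cast_one, TT_mul] at this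
    exact this.mono (by linarith)
  · have := h.pre.val.G_mul h.pre.wp.G (h.pre.val.G_op _ (h.pre.pow (p ^ j)).inv U hx)
    exact this.mono (by linarith [h.pw hj])

theorem TT_mod (p : ℕ) (j : ℕ) (hj : 1 ≤ j) : (p : ℤ) ∣ TT p j - 1 := by
  obtain ⟨j, rfl⟩ : ∃ i, j = i + 1 := ⟨j - 1, by omega⟩
  rw [TT]; exact ⟨TT p j, by ring⟩

theorem TT_mod' (p : ℕ) (j : ℕ) : (p : ℤ) ∣ TT p j - 1 := by
  cases j with
  | zero => simp [TT]
  | succ j => exact TT_mod p _ (by omega)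

theorem Lev.phiE (h : Lev p k w σ π) {j : ℕ} (hj : j < k) {m : ℤ} (hm : 0 ≤ m)
    (hd : (p : ℤ) ∣ m - 1) {x : L}
    (hx : gE w m x) : gE w (m + (p : ℤ) ^ (j + 1) - 1) (Phi p (σ ^ (p ^ j)) x) := by
  obtain ⟨U, V, -, -, hid, -⟩ := powp_id h.pre.prime (σ ^ (p ^ j))
  rw [Phi, hid]
  have g := h.gain j hj
  have h1 := g.NE1 (TT_pos p j) (TT_mod' p j) hm hd hx (p - 1) (by have := h.p3; omega)
  rw [Nat.cast_sub h.pre.prime.one_le, Nat.cast_one, TT_mul, ← add_sub_assoc] at h1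
  have := h.pre.val.G_mul h.pre.wp.G (h.pre.val.G_op _ (h.pre.pow (p ^ j)).inv U hx.G)
  exact h.pre.val.E_add h1 this (by linarith [h.pw hj])

theorem Lev.theta (h : Lev p k w σ π) (hk : 2 ≤ k) :
    gE w (TT p (k - 1) - 1) (∑ i ∈ Finset.range (p ^ (k - 1)), (σ ^ i) π) := by
  obtain ⟨K, rfl⟩ : ∃ K, k = K + 2 := ⟨k - 2, by omega⟩
  rw [show K + 2 - 1 = K + 1 by omega]
  have hp3 := h.p3
  have hval := h.pre.val
  have hy : ∀ r, r ≤ K → 1 ≤ r →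
      gG w (TT p (r + 1) - 1 - p) (∑ i ∈ Finset.range (p ^ r), (σ ^ (p * i)) π) := by
    intro r
    induction r with
    | zero => intro _ h0; omega
    | succ r ih =>
      intro hr _
      rw [pow_succ, ← Phi_sum, ← pow_succ']
      rcases Nat.eq_zero_or_pos r with rfl | h0
      · have := h.phi0 (j := 0 + 1) (by omega) (m := 1) (by norm_num) h.pre.unif.G
        simp only [pow_zero, Finset.range_one, Finset.sum_singleton, mul_zero, RingHom.one_def,
          RingHom.id_apply]
        refine this.mono ?_
        simp [TT]; nlinarith
      · have hd : (p : ℤ) ∣ TT p (r + 1) - 1 - p := dvd_sub (TT_mod' p _) dvd_rfl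
        have h0 : 0 ≤ TT p (r + 1) - 1 - p := by
          rw [TT]; nlinarith [TT_pos p r]
        have := h.phi1 (j := r + 1) (by omega) h0 hd (ih (by omega) (by omega))
        refine this.mono ?_
        rw [TT_succ p (r + 1)]; linarith
  set y := ∑ i ∈ Finset.range (p ^ K), (σ ^ (p * i)) π with hydef
  have g0 := h.gain 0 (by omega)
  rw [pow_zero, pow_one] at g0
  change Gain p w σ 1 at g0
  have hT := TT_mod' p (K + 1)
  set T := TT p (K + 1) with hTdef
  have hTp : (p : ℤ) + 1 ≤ T := by
    rw [hTdef, TT]; nlinarith [TT_pos p K]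
  have hpc : ((p - 2 : ℕ) : ℤ) = p - 2 := by
    rw [Nat.cast_sub h.pre.prime.two_le]; rfl
  have hξ : gG w (T - 2) (NN σ (p - 2) y) := by
    rcases Nat.eq_zero_or_pos K with h0 | h0
    · have e : y = π := by rw [hydef, h0]; simp
      rw [e]
      have := g0.N0 le_rfl (m := 1) (by norm_num) h.pre.unif.G (p - 2)
      refine this.mono ?_
      rw [hTdef, hpc, h0]; simp [TT]; linarith
    · have := g0.N1 le_rfl (by linarith) (dvd_sub hT dvd_rfl) (hy K le_rfl h0) (p - 2) (by omega)
      refine this.mono ?_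
      rw [hpc]; linarith
  have hy0 : gG w 0 y := hval.G_sum _ _ fun i _ => by
    have : gG w 1 ((σ ^ (p * i)) π) := (h.pre.pow _).invG.2 h.pre.unif.G
    exact this.mono (by norm_num)
  set θ := ∑ i ∈ Finset.range (p ^ (K + 1)), (σ ^ i) π with hθ
  obtain ⟨U, V, -, -, hid, -⟩ := powp_id h.pre.prime σ
  have hpg : gG w (T + 1) (p * op σ U y) := by
    have := hval.G_mul h.pre.wp.G (hval.G_op σ h.pre.inv U hy0)
    refine this.mono ?_
    have h1 := TT_mul p (K + 1)
    rw [← hTdef] at h1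
    nlinarith
  have hθy : θ = (σ (NN σ (p - 2) y) - NN σ (p - 2) y) + p * op σ U y := by
    have e1 : θ = ∑ i ∈ Finset.range p, (σ ^ i) y := by
      rw [hθ, pow_succ', sum_blocks, Finset.sum_comm]
      apply Finset.sum_congr rfl
      intro b _
      rw [hydef, map_sum]
      apply Finset.sum_congr rfl
      intro c _
      rw [← RingHom.comp_apply, ← RingHom.mul_def, ← pow_add, add_comm]
    rw [e1, hid, ← NN_succ, show p - 2 + 1 = p - 1 by omega]
  have hNθ : gE w (1 + T) (σ θ - θ) := by
    have e : σ θ - θ = (σ ^ (p ^ (K + 1))) π - π := by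
      rw [hθ, map_sum, ← Finset.sum_sub_distrib]
      have := Finset.sum_range_sub (fun i => (σ ^ i) π) (p ^ (K + 1))
      simp only [pow_zero, RingHom.one_def, RingHom.id_apply] at this
      rw [← this]
      apply Finset.sum_congr rfl
      intro i _
      rw [pow_succ', RingHom.mul_def, RingHom.comp_apply]
    rw [e]
    exact (h.gain (K + 1) (by omega)).ge 1 (by norm_num)
      (fun hd => by have := Int.le_of_dvd (by norm_num) hd; omega) π h.pre.unif
  by_cases hE : gE w (T - 2) (NN σ (p - 2) y)
  · have h1 := g0.ge (T - 2) (by linarith) (fun hd => by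
      have h2 := dvd_sub hT hd
      rw [show T - 1 - (T - 2) = 1 by ring] at h2
      have := Int.le_of_dvd (by norm_num) h2; omega) _ hE
    rw [show T - 2 + 1 = T - 1 by ring] at h1
    rw [hθy]
    exact hval.E_add h1 hpg (by linarith)
  · exfalso
    have h1 := h.pre.up hξ hE
    rw [show T - 2 + 1 = T - 1 by ring] at h1
    have h2 := g0.g1 (T - 1) (by linarith) hT _ h1
    have h3 : gG w (T + 1) θ := by
      rw [hθy]
      exact hval.G_add (h2.mono (by linarith)) hpg
    have h4 := g0.g0 (T + 1) (by linarith) _ h3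
    have := hNθ.le h4
    linarith

end phis

section traces
variable {L : Type} [Field L] {v : L → WithTop ℚ} {p k n : ℕ} {σ : L →+* L}

def wk (p k : ℕ) (v : L → WithTop ℚ) (x : L) : WithTop ℚ := (p ^ k) • v x

theorem nsmul_top {N : ℕ} (h : N ≠ 0) : N • (⊤ : WithTop ℚ) = ⊤ := by
  obtain ⟨M, rfl⟩ := Nat.exists_eq_succ_of_ne_zero h
  rw [succ_nsmul]; simp

theorem nsmul_coe (N : ℕ) (q : ℚ) : N • (q : WithTop ℚ) = ((N * q : ℚ) : WithTop ℚ) := by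
  rw [← WithTop.coe_nsmul, nsmul_eq_mul]

theorem LV.wk (h : LV v) (hp : p ≠ 0) (k : ℕ) : LV (wk p k v) where
  top x := by
    unfold _root_.wk
    rw [← h.top]
    cases hv : v x with
    | top => simp [nsmul_top (pow_ne_zero k hp)]
    | coe q => rw [nsmul_coe]; exact iff_of_false WithTop.coe_ne_top WithTop.coe_ne_top
  mul x y := by unfold _root_.wk; rw [h.mul, nsmul_add]
  add x y := by
    unfold _root_.wk
    have hm : Monotone fun a : WithTop ℚ => (p ^ k) • a := fun a b hab => nsmul_le_nsmul_right hab _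
    rw [← hm.map_min]
    exact hm (h.add x y)

theorem wk_G (hp : 0 < p) (x : L) (m : ℤ) (k : ℕ) :
    gG (wk p (k + 1) v) (p * m) x ↔ gG (wk p k v) m x := by
  unfold gG wk
  have hp' : (0 : ℚ) < p := by exact_mod_cast hp
  cases hv : v x with
  | top => simp [nsmul_top, hp.ne']
  | coe q =>
    rw [nsmul_coe, nsmul_coe, WithTop.coe_le_coe, WithTop.coe_le_coe]
    push_cast
    rw [pow_succ', mul_assoc, mul_le_mul_iff_right₀ hp']

theorem wk_E (hp : 0 < p) (x : L) (m : ℤ) (k : ℕ) :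
    gE (wk p (k + 1) v) (p * m) x ↔ gE (wk p k v) m x := by
  unfold gE wk
  have hp' : (0 : ℚ) < p := by exact_mod_cast hp
  cases hv : v x with
  | top =>
    rw [nsmul_top (pow_ne_zero _ hp.ne'), nsmul_top (pow_ne_zero _ hp.ne')]
    exact iff_of_false WithTop.top_ne_coe WithTop.top_ne_coe
  | coe q =>
    rw [nsmul_coe, nsmul_coe, WithTop.coe_eq_coe, WithTop.coe_eq_coe]
    push_cast
    rw [pow_succ', mul_assoc, mul_right_inj' hp'.ne']

structure Tow (p n : ℕ) (v : L → WithTop ℚ) (σ : L →+* L) : Prop where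
  val : LV v
  prime : p.Prime
  vp : v (p : L) = 1
  int : ∀ k ≤ n, ∀ x, (σ ^ (p ^ k)) x = x → x ≠ 0 → ∃ m : ℤ, gE (wk p k v) m x
  phi0 : ∀ k < n, ∀ x, (σ ^ (p ^ (k + 1))) x = x → ∀ m : ℤ, 0 ≤ m → gG (wk p (k + 1) v) m x →
    gG (wk p (k + 1) v) (m + (p : ℤ) ^ (k + 1) - 1) (Phi p (σ ^ (p ^ k)) x)
  phi1 : ∀ k < n, ∀ x, (σ ^ (p ^ (k + 1))) x = x → ∀ m : ℤ, 0 ≤ m → (p : ℤ) ∣ m →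
    gG (wk p (k + 1) v) m x →
    gG (wk p (k + 1) v) (m + (p : ℤ) ^ (k + 1)) (Phi p (σ ^ (p ^ k)) x)
  phiE : ∀ k < n, ∀ x, (σ ^ (p ^ (k + 1))) x = x → ∀ m : ℤ, 0 ≤ m → (p : ℤ) ∣ m - 1 →
    gE (wk p (k + 1) v) m x →
    gE (wk p (k + 1) v) (m + (p : ℤ) ^ (k + 1) - 1) (Phi p (σ ^ (p ^ k)) x)

noncomputable def Tr (p k : ℕ) (σ : L →+* L) (x : L) : L := ∑ i ∈ Finset.range (p ^ k), (σ ^ i) x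

def SS (p : ℕ) : ℕ → ℤ
  | 0 => 0
  | (j + 1) => TT p j

theorem SS_succ (p k : ℕ) : SS p (k + 1) = p * SS p k + 1 := by
  cases k with
  | zero => simp [SS, TT]
  | succ k => simp [SS, TT]

theorem SS_nonneg (p k : ℕ) : 0 ≤ SS p k := by
  cases k with
  | zero => simp [SS]
  | succ k => have := TT_pos p k; simp only [SS]; omega

theorem Tr_succ (x : L) : Tr p (k + 1) σ x = Tr p k σ (Phi p (σ ^ (p ^ k)) x) := by
  rw [Tr, pow_succ, sum_blocks, Finset.sum_comm, Tr]
  apply Finset.sum_congr rfl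
  intro b _
  rw [Phi, map_sum]
  apply Finset.sum_congr rfl
  intro c _
  rw [← RingHom.comp_apply, ← RingHom.mul_def, ← pow_mul, ← pow_add, add_comm]

theorem Phi_fix {τ : L →+* L} {x : L} (hx : (τ ^ p) x = x) : τ (Phi p τ x) = Phi p τ x := by
  rw [Phi, map_sum]
  have h1 : ∀ i, τ ((τ ^ i) x) = (τ ^ (i + 1)) x := fun i => by rw [pow_succ']; rfl
  simp only [h1]
  have h2 := Finset.sum_range_succ (fun i => (τ ^ i) x) p
  rw [Finset.sum_range_succ' (fun i => (τ ^ i) x) p, hx] at h2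
  simpa using h2

theorem Tr_div (y : L) : Tr p k σ (y / p) = Tr p k σ y / p := by
  simp [Tr, Finset.sum_div]

theorem Tow.vpE (h : Tow p n v σ) (k : ℕ) : gE (wk p k v) ((p : ℤ) ^ k) (p : L) := by
  unfold gE wk
  rw [h.vp, show (1 : WithTop ℚ) = ((1 : ℚ) : WithTop ℚ) from rfl, nsmul_coe]
  push_cast; simp

theorem Tow.wv (h : Tow p n v σ) (k : ℕ) : LV (wk p k v) := h.val.wk h.prime.ne_zero k

theorem Tow.fixdiv (h : Tow p n v σ) (x : L) (hx : (σ ^ (p ^ (k + 1))) x = x) :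
    (σ ^ (p ^ k)) (Phi p (σ ^ (p ^ k)) x / p) = Phi p (σ ^ (p ^ k)) x / p := by
  rw [map_div₀, Phi_fix, map_natCast]
  rwa [← pow_mul, ← pow_succ]

theorem Tow.backG (h : Tow p n v σ) {m : ℤ} {y : L} (hy : gG (wk p 0 v) m (Tr p k σ (y / p))) :
    gG (wk p 0 v) (m + 1) (Tr p k σ y) := by
  rw [Tr_div] at hy
  have := (h.wv 0).G_mul hy (h.vpE 0).G
  rwa [div_mul_cancel₀ _ ((h.wv 0).E_ne (h.vpE 0)), pow_zero] at this

theorem Tow.backE (h : Tow p n v σ) {m : ℤ} {y : L} (hy : gE (wk p 0 v) m (Tr p k σ (y / p))) :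
    gE (wk p 0 v) (m + 1) (Tr p k σ y) := by
  rw [Tr_div] at hy
  have := (h.wv 0).E_mul hy (h.vpE 0)
  rwa [div_mul_cancel₀ _ ((h.wv 0).E_ne (h.vpE 0)), pow_zero] at this

theorem Tow.divG (h : Tow p n v σ) {m : ℤ} {y : L} (hy : gG (wk p k v) (m + (p : ℤ) ^ k) y) :
    gG (wk p k v) m (y / p) := by
  simpa using (h.wv k).G_div hy (h.vpE k)

theorem Tow.divE (h : Tow p n v σ) {m : ℤ} {y : L} (hy : gE (wk p k v) (m + (p : ℤ) ^ k) y) :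
    gE (wk p k v) m (y / p) := by
  simpa using (h.wv k).E_div hy (h.vpE k)

theorem Tow.trA (h : Tow p n v σ) (k : ℕ) (hk : k ≤ n) (x : L) (hf : (σ ^ (p ^ k)) x = x)
    (hx : gG (wk p k v) 0 x) : gG (wk p 0 v) k (Tr p k σ x) := by
  induction k generalizing x with
  | zero => simpa [Tr] using hx
  | succ k ih =>
    rw [Tr_succ]
    push_cast
    apply h.backG
    apply ih (by omega) _ (h.fixdiv x hf)
    apply h.divG
    have := h.phi1 k (by omega) x hf 0 le_rfl (dvd_zero _) hx
    rw [← wk_G h.prime.pos]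
    exact this.mono (by rw [pow_succ]; linarith)

theorem Tow.trB (h : Tow p n v σ) (k : ℕ) (hk : k ≤ n) (x : L) (hf : (σ ^ (p ^ k)) x = x)
    (hx : gE (wk p k v) (SS p k) x) : gE (wk p 0 v) k (Tr p k σ x) := by
  induction k generalizing x with
  | zero => simpa [Tr, SS] using hx
  | succ k ih =>
    rw [Tr_succ]
    push_cast
    apply h.backE
    apply ih (by omega) _ (h.fixdiv x hf)
    apply h.divE
    have := h.phiE k (by omega) x hf _ (SS_nonneg p _) (by rw [SS_succ]; exact ⟨SS p k, by ring⟩) hx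
    rw [← wk_E h.prime.pos]
    convert this using 1
    rw [SS_succ, pow_succ]; ring

theorem Tow.trC (h : Tow p n v σ) (k : ℕ) (hk : k ≤ n) (x : L) (hf : (σ ^ (p ^ k)) x = x)
    (hx : gG (wk p k v) (SS p k + 1) x) : gG (wk p 0 v) (k + 1) (Tr p k σ x) := by
  induction k generalizing x with
  | zero => simpa [Tr, SS] using hx
  | succ k ih =>
    rw [Tr_succ]
    push_cast
    apply h.backG
    apply ih (by omega) _ (h.fixdiv x hf)
    apply h.divG
    have h1 := h.phi0 k (by omega) x hf _ (by have := SS_nonneg p (k + 1); omega) hx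
    set y := Phi p (σ ^ (p ^ k)) x
    by_cases h0 : y = 0
    · rw [h0]; exact (h.wv k).G_zero _
    have hyf : (σ ^ (p ^ k)) y = y := Phi_fix (by rwa [← pow_mul, ← pow_succ])
    obtain ⟨m, hm⟩ := h.int k (by omega) y hyf h0
    have h2 := ((wk_E h.prime.pos y m k).2 hm).le h1
    apply hm.Gle
    rw [SS_succ, pow_succ] at h2
    have hp : (0 : ℤ) < p := by exact_mod_cast h.prime.pos
    by_contra hc
    push Not at hc
    have h3 : m ≤ SS p k + (p : ℤ) ^ k := by linarith
    nlinarith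

end traces

section fin1
variable {L A : Type} [Field L] [Field A] {u : A → WithTop ℚ} {emb : L →+* A} {p n : ℕ}
  {σ : L →+* L} {π : L}

theorem LV.gt_sum (h : LV u) {r : WithTop ℚ} (hr : r ≠ ⊤) {ι : Type} (s : Finset ι) (f : ι → A)
    (hf : ∀ i ∈ s, r < u (f i)) : r < u (∑ i ∈ s, f i) := by
  classical
  induction s using Finset.induction_on with
  | empty => simpa [h.zero] using lt_top_iff_ne_top.2 hr
  | insert a s ha ih =>
    rw [Finset.sum_insert ha]
    refine lt_of_lt_of_le (lt_min ?_ ?_) (h.add _ _)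
    · exact hf a (by simp)
    · exact ih fun i hi => hf i (by simp [hi])

theorem Tr_add (k : ℕ) (x y : L) : Tr p k σ (x + y) = Tr p k σ x + Tr p k σ y := by
  simp [Tr, Finset.sum_add_distrib]

theorem Tr_sub (k : ℕ) (x y : L) : Tr p k σ (x - y) = Tr p k σ x - Tr p k σ y := by
  simp [Tr, Finset.sum_sub_distrib]

theorem Tr_sum (k : ℕ) {ι : Type} (s : Finset ι) (f : ι → L) :
    Tr p k σ (∑ i ∈ s, f i) = ∑ i ∈ s, Tr p k σ (f i) := by
  simp only [Tr, map_sum]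
  rw [Finset.sum_comm]

theorem Tr_fix (k : ℕ) (hord : σ ^ (p ^ k) = 1) (x : L) : σ (Tr p k σ x) = Tr p k σ x := by
  have := Phi_fix (p := p ^ k) (τ := σ) (x := x) (by rw [hord]; rfl)
  simpa [Phi, Tr] using this

theorem Tr_smul (k : ℕ) {a : L} (ha : σ a = a) (x : L) : Tr p k σ (a * x) = a * Tr p k σ x := by
  simp only [Tr, map_mul, pow_fix a ha, Finset.mul_sum]

theorem final_S (T : Tow p n (fun x => u (emb x)) σ) (hL : Lev p n (wk p n fun x => u (emb x)) σ π)
    (hn : 1 ≤ n) (hu : LV u) {ζ : A} (hω : ∑ i ∈ Finset.range p, ζ ^ (p ^ (n - 1) * i) = 0)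
    (hζ : 0 < u (ζ - 1)) :
    gE (wk p 0 u) (n + 1)
      (∑ i ∈ Finset.range (p ^ n), ζ ^ i * emb (Tr p n σ ((σ ^ i) π * π))) := by
  obtain ⟨N, rfl⟩ : ∃ N, n = N + 1 := ⟨n - 1, by omega⟩
  rw [Nat.add_sub_cancel] at hω
  set v : L → WithTop ℚ := fun x => u (emb x) with hv
  have hfix : ∀ x, (σ ^ (p ^ (N + 1))) x = x := fun x => by rw [hL.ord]; rfl
  have hu0 : LV (wk p 0 u) := hu.wk T.prime.ne_zero 0
  set f : ℕ → L := fun i => Tr p (N + 1) σ ((σ ^ i) π * π) with hf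
  set q := p ^ N with hq
  have hζ0 : 0 ≤ u ζ := by
    have := hu.ge_add hζ.le hu.one.ge
    simpa using this
  have hζi0 : ∀ i : ℕ, 0 ≤ u (ζ ^ i) := fun i => by
    rw [hu.pow]; exact nsmul_nonneg hζ0 i
  have hζi : ∀ i : ℕ, 0 < u (ζ ^ i - 1) := fun i => by
    rw [← geom_sum_mul, hu.mul]
    exact lt_of_lt_of_le hζ (le_add_of_nonneg_left (hu.ge_sum _ _ fun i _ => hζi0 i))
  have hwv := T.wv (N + 1)
  have hg := hL.gain N (by omega)
  have hc : ∀ c : ℕ, ∀ x, gG (wk p (N + 1) v) 1 x →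
      gG (wk p (N + 1) v) (1 + TT p N) (((σ ^ q) ^ c) x - x) := by
    intro c x hx
    induction c with
    | zero => simpa using hwv.G_zero _
    | succ c ih =>
      have e : ((σ ^ q) ^ (c + 1)) x - x
          = ((σ ^ q) (((σ ^ q) ^ c) x) - ((σ ^ q) ^ c) x) + (((σ ^ q) ^ c) x - x) := by
        rw [pow_succ', RingHom.mul_def, RingHom.comp_apply]; ring
      rw [e]
      refine hwv.G_add (hg.g0 1 (by norm_num) _ ?_) ih
      exact ((hL.pre.pow q).pow c).invG.2 hx
  have hh : ∀ c b : ℕ, gG (wk p 0 v) (N + 1 + 1) (f (q * c + b) - f b) := by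
    intro c b
    have e : f (q * c + b) - f b
        = Tr p (N + 1) σ ((((σ ^ q) ^ c) ((σ ^ b) π) - (σ ^ b) π) * π) := by
      rw [hf]; dsimp only
      rw [← Tr_sub, sub_mul, ← pow_mul, pow_add, RingHom.mul_def, RingHom.comp_apply]
    rw [e]
    have hb : gG (wk p (N + 1) v) 1 ((σ ^ b) π) := (hL.pre.pow b).invG.2 hL.pre.unif.G
    have := T.trC (N + 1) le_rfl _ (hfix _)
      ((hwv.G_mul (hc c _ hb) hL.pre.unif.G).mono (by simp only [SS]; linarith))
    exact_mod_cast this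
  -- main term
  have hM : gE (wk p 0 v) (N + 1 + 1)
      (∑ c ∈ Finset.range p, ∑ b ∈ Finset.range q, (f (q * c + b) - f b)) := by
    have e1 : ∑ i ∈ Finset.range (p ^ (N + 1)), f i
        = Tr p (N + 1) σ π * Tr p (N + 1) σ π := by
      rw [← Tr_smul (N + 1) (Tr_fix _ hL.ord π)]
      rw [hf, ← Tr_sum, ← Finset.sum_mul]
      rfl
    have e2 : ∑ b ∈ Finset.range q, f b
        = Tr p (N + 1) σ ((∑ b ∈ Finset.range q, (σ ^ b) π) * π) := by
      rw [hf, ← Tr_sum, ← Finset.sum_mul]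
    have e : ∑ c ∈ Finset.range p, ∑ b ∈ Finset.range q, (f (q * c + b) - f b)
        = Tr p (N + 1) σ π * Tr p (N + 1) σ π
          - p * Tr p (N + 1) σ ((∑ b ∈ Finset.range q, (σ ^ b) π) * π) := by
      simp only [Finset.sum_sub_distrib]
      rw [← sum_blocks, ← pow_succ, e1, e2]
      simp
    rw [e]
    have hpE : gE (wk p 0 v) 1 (p : L) := by simpa using T.vpE 0
    have h0 := T.wv 0
    rcases Nat.eq_zero_or_pos N with h00 | h00
    · subst h00
      have h1 := T.trB (0 + 1) le_rfl π (hfix π) (by simpa [SS, TT] using hL.pre.unif)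
      have h2 := T.trC (0 + 1) le_rfl (π * π) (hfix _)
        (by simpa [SS, TT] using (hwv.E_mul hL.pre.unif hL.pre.unif).G)
      rw [sub_eq_add_neg]
      have e3 : (∑ b ∈ Finset.range q, (σ ^ b) π) = π := by rw [hq]; simp
      rw [e3]
      have h3 := h0.E_mul h1 h1
      have h4 := h0.G_neg (h0.G_mul hpE.G h2)
      have := h0.E_add h3 h4 (by simp)
      simpa using this
    · have h1 := T.trA (N + 1) le_rfl π (hfix π) (hL.pre.unif.Gle (by norm_num))
      have h2 := hL.theta (by omega)
      rw [Nat.add_sub_cancel] at h2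
      have h3 := hwv.E_mul h2 hL.pre.unif
      rw [sub_add_cancel] at h3
      have h4 := T.trB (N + 1) le_rfl _ (hfix _) h3
      have h5 := h0.E_neg (h0.E_mul hpE h4)
      rw [sub_eq_add_neg, add_comm (_ * _) (-_)]
      have := h0.E_add h5 (h0.G_mul h1 h1) (by push_cast; omega)
      convert this using 1
      push_cast; ring
  have hMA : gE (wk p 0 u) (N + 1 + 1)
      (emb (∑ c ∈ Finset.range p, ∑ b ∈ Finset.range q, (f (q * c + b) - f b))) := hM
  have hsum : ∑ i ∈ Finset.range (p ^ (N + 1)), ζ ^ i * emb (Tr p (N + 1) σ ((σ ^ i) π * π))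
      = emb (∑ c ∈ Finset.range p, ∑ b ∈ Finset.range q, (f (q * c + b) - f b))
        + ∑ c ∈ Finset.range p, ∑ b ∈ Finset.range q,
          (ζ ^ (q * c + b) - 1) * emb (f (q * c + b) - f b) := by
    rw [map_sum, ← Finset.sum_add_distrib]
    have e1 : ∀ c, emb (∑ b ∈ Finset.range q, (f (q * c + b) - f b))
          + ∑ b ∈ Finset.range q, (ζ ^ (q * c + b) - 1) * emb (f (q * c + b) - f b)
        = ∑ b ∈ Finset.range q, ζ ^ (q * c + b) * emb (f (q * c + b))
          - ζ ^ (q * c) * ∑ b ∈ Finset.range q, ζ ^ b * emb (f b) := by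
      intro c
      rw [map_sum, Finset.mul_sum, ← Finset.sum_add_distrib, ← Finset.sum_sub_distrib]
      apply Finset.sum_congr rfl
      intro b _
      rw [map_sub, pow_add]; ring
    simp only [e1]
    rw [Finset.sum_sub_distrib, ← Finset.sum_mul, hω, zero_mul, sub_zero, pow_succ, sum_blocks]
  rw [hsum]
  unfold gE at hMA ⊢
  push_cast at hMA ⊢
  rw [← hMA]
  apply hu0.eq_add
  rw [hMA]
  apply hu0.gt_sum (WithTop.coe_ne_top (a := ((N : ℚ) + 1 + 1)))
  intro c _
  apply hu0.gt_sum (WithTop.coe_ne_top (a := ((N : ℚ) + 1 + 1)))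
  intro b _
  rw [hu0.mul]
  have h1 := hh c b
  have h2 : 0 < wk p 0 u (ζ ^ (q * c + b) - 1) := by
    unfold wk; simpa using hζi (q * c + b)
  have h3 : ((((N : ℤ) + 1 + 1 : ℤ) : ℚ) : WithTop ℚ) ≤ wk p 0 u (emb (f (q * c + b) - f b)) := h1
  push_cast at h3
  refine lt_of_lt_of_le ?_ (add_le_add_right h3 _)
  have h4 : (((N : ℚ) + 1 + 1 : ℚ) : WithTop ℚ) ≠ ⊤ := WithTop.coe_ne_top
  have := WithTop.add_lt_add_left h4 h2
  rw [add_zero, add_comm _ (wk p 0 u _)] at this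
  push_cast at this
  exact this

end fin1

section padic
open Polynomial

theorem sqrt_exists {p : ℕ} [Fact p.Prime] (hp : Odd p) (x : ℤ_[p]) :
    ∃ y : ℤ_[p], y ^ 2 = 1 + p * x ^ 2 := by
  have h2 : ‖(2 : ℤ_[p])‖ = 1 := by
    have h1 := PadicInt.norm_natCast_eq_one_iff (p := p) (n := 2)
    rw [Nat.cast_ofNat] at h1
    rw [h1]
    exact (Nat.coprime_two_right.2 hp)
  have hF := hensels_lemma (p := p) (F := (X ^ 2 - C (1 + p * x ^ 2) : ℤ_[p][X])) (a := 1) (by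
    have e1 : (aeval (1 : ℤ_[p])) (X ^ 2 - C (1 + p * x ^ 2) : ℤ_[p][X]) = -(p * x ^ 2) := by
      simp
    have e2 : (aeval (1 : ℤ_[p])) (derivative (X ^ 2 - C (1 + p * x ^ 2) : ℤ_[p][X])) = 2 := by
      generalize (1 + p * x ^ 2 : ℤ_[p]) = b
      simp [one_add_one_eq_two]
    rw [e1, e2, h2, norm_neg, norm_mul]
    have h3 : ‖(p : ℤ_[p])‖ < 1 := by rw [PadicInt.norm_p]; exact inv_lt_one_of_one_lt₀ (by exact_mod_cast (Fact.out : p.Prime).one_lt)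
    have h4 : ‖x ^ 2‖ ≤ 1 := PadicInt.norm_le_one _
    nlinarith [norm_nonneg (p : ℤ_[p]), norm_nonneg (x ^ 2)])
  obtain ⟨z, hz, -⟩ := hF
  refine ⟨z, ?_⟩
  have : z ^ 2 - (1 + p * x ^ 2) = 0 := by simpa using hz
  exact sub_eq_zero.1 this

variable {p : ℕ} [Fact p.Prime] {M : Type} [Field M] [Algebra ℚ_[p] M] {w : M → WithTop ℚ}

theorem val_zp (hp : Odd p) (h : LV w) (hwp : w (p : M) = 1)
    (hint : ∀ x : ℚ_[p], x ≠ 0 → ∃ m : ℤ, gE w m (algebraMap ℚ_[p] M x)) (x : ℤ_[p]) :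
    gG w 0 (algebraMap ℚ_[p] M x) := by
  by_cases hx0 : (x : ℚ_[p]) = 0
  · rw [hx0, map_zero]; exact h.G_zero _
  obtain ⟨m, hm⟩ := hint x hx0
  by_contra hc
  have hm0 : m < 0 := by
    by_contra h1
    exact hc (hm.Gle (by omega))
  obtain ⟨y, hy⟩ := sqrt_exists hp x
  have hpE : gE w 1 (p : M) := by unfold gE; rw [hwp]; simp
  have hy' : algebraMap ℚ_[p] M y ^ 2 = p * (algebraMap ℚ_[p] M x * algebraMap ℚ_[p] M x) + 1 := by
    have : (y : ℚ_[p]) ^ 2 = 1 + p * (x : ℚ_[p]) ^ 2 := by exact_mod_cast congrArg _ hy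
    rw [← map_pow, this]
    simp only [map_add, map_one, map_mul, map_pow, map_natCast]; ring
  have h1 := h.E_add (h.E_mul hpE (h.E_mul hm hm)) h.E_one.G (by omega)
  rw [← hy'] at h1
  have hy0 : (y : ℚ_[p]) ≠ 0 := by
    intro h0
    rw [h0] at h1
    simp only [map_zero, ne_eq, OfNat.ofNat_ne_zero, not_false_eq_true, zero_pow] at h1
    exact h.E_ne h1 rfl
  obtain ⟨m', hm'⟩ := hint y hy0
  have h2 := h.E_pow hm' 2
  have := h2.uniq h1
  push_cast at this
  omega

theorem val_qp (hp : Odd p) (h : LV w) (hwp : w (p : M) = 1)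
    (hint : ∀ x : ℚ_[p], x ≠ 0 → ∃ m : ℤ, gE w m (algebraMap ℚ_[p] M x)) (x : ℚ_[p]) (hx : x ≠ 0) :
    gE w x.valuation (algebraMap ℚ_[p] M x) := by
  have hpE : gE w 1 (p : M) := by unfold gE; rw [hwp]; simp
  have unit : ∀ y : ℚ_[p], ‖y‖ = 1 → gE w 0 (algebraMap ℚ_[p] M y) := by
    intro y hy
    have hy0 : y ≠ 0 := by rintro rfl; simp at hy
    obtain ⟨m, hm⟩ := hint y hy0
    have h1 := hm.le (val_zp hp h hwp hint ⟨y, hy.le⟩)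
    have h2 : gE w (0 - m) (algebraMap ℚ_[p] M y⁻¹) := by
      rw [map_inv₀]
      have := h.E_div h.E_one hm
      simpa using this
    have h3 := h2.le (val_zp hp h hwp hint ⟨y⁻¹, by rw [norm_inv, hy, inv_one]⟩)
    have : m = 0 := by omega
    rwa [this] at hm
  have hz : ∀ k : ℤ, gE w k ((p : M) ^ k) := by
    intro k
    obtain ⟨j, rfl | rfl⟩ := k.eq_nat_or_neg
    · simpa using h.E_pow hpE j
    · have := h.E_div h.E_one (h.E_pow hpE j)
      simpa using this
  have hp0 : (p : ℚ_[p]) ≠ 0 := by exact_mod_cast (Fact.out : p.Prime).ne_zero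
  have h1 := unit (x / (p : ℚ_[p]) ^ x.valuation) (by
    rw [norm_div, Padic.norm_eq_zpow_neg_valuation hx, Padic.norm_p_zpow, div_self]
    exact zpow_ne_zero _ (by exact_mod_cast (Fact.out : p.Prime).ne_zero))
  have h2 := h.E_mul h1 (hz x.valuation)
  rw [map_div₀, map_zpow₀, map_natCast, div_mul_cancel₀, zero_add] at h2
  · exact h2
  · exact h.E_ne (hz _)

theorem val_inv (hp : Odd p) (h : LV w) (hwp : w (p : M) = 1)
    (hint : ∀ x : ℚ_[p], x ≠ 0 → ∃ m : ℤ, gE w m (algebraMap ℚ_[p] M x))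
    [Algebra.IsAlgebraic ℚ_[p] M] (ψ : M ≃ₐ[ℚ_[p]] M) (x : M) : w (ψ x) = w x := by
  classical
  have hp1 : (1 : ℝ) < p := by exact_mod_cast (Fact.out : p.Prime).one_lt
  have hp0 : (0 : ℝ) < p := by linarith
  let g : WithTop ℚ → ℝ := fun a => WithTop.recTopCoe 0 (fun q : ℚ => (p : ℝ) ^ (-(q : ℝ))) a
  have gtop : g ⊤ = 0 := rfl
  have gcoe : ∀ q : ℚ, g (q : WithTop ℚ) = (p : ℝ) ^ (-(q : ℝ)) := fun q => rfl
  have gpos : ∀ q : ℚ, 0 < g (q : WithTop ℚ) := fun q => by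
    rw [gcoe]; exact Real.rpow_pos_of_pos hp0 _
  have gnn : ∀ a, 0 ≤ g a := fun a => by
    cases a with
    | top => rw [gtop]
    | coe q => exact (gpos q).le
  have ganti : ∀ a b, a ≤ b → g b ≤ g a := by
    intro a b hab
    cases b with
    | top => rw [gtop]; exact gnn a
    | coe b =>
      cases a with
      | top => simp at hab
      | coe a =>
        rw [gcoe, gcoe, Real.rpow_le_rpow_left_iff hp1]
        have : a ≤ b := by exact_mod_cast hab
        have : (a : ℝ) ≤ b := by exact_mod_cast this
        linarith
  have ginj : ∀ a b, g a = g b → a = b := by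
    intro a b hab
    cases a with
    | top =>
      cases b with
      | top => rfl
      | coe b => rw [gtop] at hab; exact absurd hab (gpos b).ne
    | coe a =>
      cases b with
      | top => rw [gtop] at hab; exact absurd hab (gpos a).ne'
      | coe b =>
        rw [gcoe, gcoe] at hab
        have h1 := le_antisymm ((Real.rpow_le_rpow_left_iff hp1).1 hab.le)
          ((Real.rpow_le_rpow_left_iff hp1).1 hab.ge)
        have : (a : ℝ) = b := by linarith
        have : a = b := by exact_mod_cast this
        rw [this]
  have gmul : ∀ a b, g (a + b) = g a * g b := by
    intro a b
    cases a with
    | top => simp [gtop]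
    | coe a =>
      cases b with
      | top => simp [gtop]
      | coe b =>
        rw [← WithTop.coe_add, gcoe, gcoe, gcoe, ← Real.rpow_add hp0]
        congr 1; push_cast; ring
  let f : AbsoluteValue M ℝ :=
    { toFun := fun x => g (w x)
      map_mul' := fun x y => by simp only [h.mul, gmul]
      nonneg' := fun x => gnn _
      eq_zero' := fun x => by
        constructor
        · intro h0
          exact (h.top x).1 (ginj _ _ (h0.trans gtop.symm))
        · rintro rfl
          change g (w 0) = 0
          rw [h.zero, gtop]
      add_le' := fun x y => by
        have h1 := ganti _ _ (h.add x y)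
        refine h1.trans ?_
        rcases min_choice (w x) (w y) with h2 | h2
        · rw [h2]; exact le_add_of_nonneg_right (gnn _)
        · rw [h2]; exact le_add_of_nonneg_left (gnn _) }
  have hf : ∀ x, f x = g (w x) := fun x => rfl
  have hext : ∀ x : ℚ_[p], f (algebraMap ℚ_[p] M x) = ‖x‖ := by
    intro x
    by_cases hx : x = 0
    · rw [hx]; simp
    have h1 := val_qp hp h hwp hint x hx
    unfold gE at h1
    rw [hf, h1, gcoe, Padic.norm_eq_zpow_neg_valuation hx, ← Real.rpow_intCast]
    push_cast; rfl
  apply ginj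
  rw [← hf, ← hf, spectralNorm_unique_field_norm_ext hext, spectralNorm_unique_field_norm_ext hext,
    ← spectralNorm_eq_of_equiv]

end padic

section expand
variable {K E : Type} [Field K] [Field E] [Algebra K E] {w : E → WithTop ℚ} {e : ℕ} {π : E}

theorem term_val (h : LV w)
    (hK : ∀ a : K, a ≠ 0 → ∃ m : ℤ, gE w (e * m) (algebraMap K E a)) (hπ : gE w 1 π)
    (a : K) (ha : a ≠ 0) (j : ℕ) : ∃ m : ℤ, gE w (e * m + j) (algebraMap K E a * π ^ j) := by
  obtain ⟨m, hm⟩ := hK a ha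
  exact ⟨m, by simpa using h.E_mul hm (h.E_pow hπ j)⟩

theorem mod_ne {e j i : ℕ} (hj : j < e) (hi : i < e) (hne : j ≠ i) (m m' : ℤ) :
    (e : ℤ) * m + j ≠ e * m' + i := by
  intro h
  have h1 : ((e : ℤ) * m + j) % e = j := by
    rw [Int.mul_add_emod_self_left]; exact Int.emod_eq_of_lt (by omega) (by omega)
  have h2 : ((e : ℤ) * m' + i) % e = i := by
    rw [Int.mul_add_emod_self_left]; exact Int.emod_eq_of_lt (by omega) (by omega)
  rw [h, h2] at h1
  omega

theorem expand_val (h : LV w)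
    (hK : ∀ a : K, a ≠ 0 → ∃ m : ℤ, gE w (e * m) (algebraMap K E a)) (hπ : gE w 1 π)
    (a : ℕ → K) (N : ℕ) (hN : N ≤ e) :
    (∀ j < N, a j = 0) ∨ ∃ m : ℤ, ∃ j < N, (∃ m' : ℤ, m = e * m' + j) ∧
      gE w m (∑ i ∈ Finset.range N, algebraMap K E (a i) * π ^ i) ∧
      ∀ i < N, gG w m (algebraMap K E (a i) * π ^ i) := by
  induction N with
  | zero => left; intro j hj; omega
  | succ N ih =>
    rw [Finset.sum_range_succ]
    have ih := ih (by omega)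
    by_cases haN : a N = 0
    · rcases ih with h0 | ⟨m, j, hj, hm', hE, hG⟩
      · left
        intro j hj
        rcases Nat.lt_succ_iff_lt_or_eq.1 hj with h1 | rfl
        · exact h0 j h1
        · exact haN
      · right
        refine ⟨m, j, by omega, hm', by simpa [haN] using hE, ?_⟩
        intro i hi
        rcases Nat.lt_succ_iff_lt_or_eq.1 hi with h1 | rfl
        · exact hG i h1
        · rw [haN]; simpa using h.G_zero m
    · right
      obtain ⟨mN, hmN⟩ := term_val h hK hπ (a N) haN N
      rcases ih with h0 | ⟨m, j, hj, ⟨m', rfl⟩, hE, hG⟩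
      · refine ⟨_, N, by omega, ⟨mN, rfl⟩, ?_, ?_⟩
        · rw [Finset.sum_eq_zero, zero_add]
          · exact hmN
          · intro i hi
            rw [h0 i (Finset.mem_range.1 hi)]; simp
        · intro i hi
          rcases Nat.lt_succ_iff_lt_or_eq.1 hi with h1 | rfl
          · rw [h0 i h1]; simpa using h.G_zero _
          · exact hmN.G
      · have hne := mod_ne (by omega : j < e) (by omega : N < e) (by omega) m' mN
        rcases lt_or_gt_of_ne hne with hlt | hlt
        · refine ⟨_, j, by omega, ⟨m', rfl⟩, h.E_add hE hmN.G hlt, ?_⟩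
          intro i hi
          rcases Nat.lt_succ_iff_lt_or_eq.1 hi with h1 | rfl
          · exact hG i h1
          · exact hmN.Gle hlt.le
        · refine ⟨_, N, by omega, ⟨mN, rfl⟩, ?_, ?_⟩
          · rw [add_comm (Finset.sum _ _)]
            exact h.E_add hmN hE.G hlt
          intro i hi
          rcases Nat.lt_succ_iff_lt_or_eq.1 hi with h1 | rfl
          · exact (hG i h1).mono hlt.le
          · exact hmN.G

theorem expand_ex [FiniteDimensional K E] (h : LV w)
    (hK : ∀ a : K, a ≠ 0 → ∃ m : ℤ, gE w (e * m) (algebraMap K E a)) (hπ : gE w 1 π)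
    (he : Module.finrank K E = e) (x : E) :
    ∃ a : ℕ → K, x = ∑ i ∈ Finset.range e, algebraMap K E (a i) * π ^ i := by
  classical
  have hli : LinearIndependent K (fun i : Fin e => π ^ (i : ℕ)) := by
    rw [Fintype.linearIndependent_iff]
    intro g hg i
    let a : ℕ → K := fun j => if hj : j < e then g ⟨j, hj⟩ else 0
    have ha : ∀ i : Fin e, a i = g i := fun i => by simp [a]
    have hs : ∑ i ∈ Finset.range e, algebraMap K E (a i) * π ^ i = 0 := by
      rw [Finset.sum_range, ← hg]
      apply Finset.sum_congr rfl
      intro i _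
      rw [ha, Algebra.smul_def]
    rcases expand_val h hK hπ a e le_rfl with h0 | ⟨m, j, hj, -, hE, -⟩
    · rw [← ha]; exact h0 i i.2
    · rw [hs] at hE
      exact absurd rfl (h.E_ne hE)
  have hsp := hli.span_eq_top_of_card_eq_finrank' (by simp [he])
  have hx : x ∈ Submodule.span K (Set.range fun i : Fin e => π ^ (i : ℕ)) := by
    rw [hsp]; trivial
  obtain ⟨c, hc⟩ := (Submodule.mem_span_range_iff_exists_fun K).1 hx
  refine ⟨fun j => if hj : j < e then c ⟨j, hj⟩ else 0, ?_⟩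
  rw [Finset.sum_range, ← hc]
  apply Finset.sum_congr rfl
  intro i _
  simp [Algebra.smul_def]

theorem expand_int [FiniteDimensional K E] (h : LV w)
    (hK : ∀ a : K, a ≠ 0 → ∃ m : ℤ, gE w (e * m) (algebraMap K E a)) (hπ : gE w 1 π)
    (he : Module.finrank K E = e) (x : E) (hx : x ≠ 0) : ∃ m : ℤ, gE w m x := by
  obtain ⟨a, rfl⟩ := expand_ex h hK hπ he x
  rcases expand_val h hK hπ a e le_rfl with h0 | ⟨m, j, hj, -, hE, -⟩
  · exfalso
    apply hx
    apply Finset.sum_eq_zero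
    intro i hi
    rw [h0 i (Finset.mem_range.1 hi)]; simp
  · exact ⟨m, hE⟩

theorem expand_res [FiniteDimensional K E] (h : LV w)
    (hK : ∀ a : K, a ≠ 0 → ∃ m : ℤ, gE w (e * m) (algebraMap K E a)) (hπ : gE w 1 π)
    (he : Module.finrank K E = e) (he0 : 0 < e) (x : E) (hx : gG w 0 x) :
    ∃ a : K, gG w 1 (x - algebraMap K E a) := by
  obtain ⟨a, rfl⟩ := expand_ex h hK hπ he x
  refine ⟨a 0, ?_⟩
  obtain ⟨d, rfl⟩ : ∃ d, e = d + 1 := ⟨e - 1, by omega⟩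
  have hG : ∀ i < d + 1, gG w 0 (algebraMap K E (a i) * π ^ i) := by
    rcases expand_val h hK hπ a (d + 1) le_rfl with h0 | ⟨m, j, hj, -, hE, hG⟩
    · intro i hi
      rw [h0 i hi]; simpa using h.G_zero _
    · intro i hi
      exact (hG i hi).mono (hE.le hx)
  rw [Finset.sum_range_succ']
  simp only [pow_zero, mul_one, add_sub_cancel_right]
  apply h.G_sum
  intro i hi
  rw [Finset.mem_range] at hi
  by_cases h0 : a (i + 1) = 0
  · rw [h0]; simpa using h.G_zero _
  obtain ⟨m, hm⟩ := term_val h hK hπ (a (i + 1)) h0 (i + 1)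
  have h1 := hm.le (hG (i + 1) (by omega))
  have h2 := mod_ne (by omega : i + 1 < d + 1) (by omega : 0 < d + 1) (by omega) m 0
  apply hm.Gle
  push_cast at h1 h2 ⊢
  omega

end expand

section mk
variable {K E : Type} [Field K] [Field E] [Algebra K E] [FiniteDimensional K E]
  {v : E → WithTop ℚ} {p k : ℕ} {σ : E →+* E} {π : E}

theorem wkK (hK : ∀ a : K, a ≠ 0 → ∃ m : ℤ, gE v m (algebraMap K E a)) (a : K) (ha : a ≠ 0) :
    ∃ m : ℤ, gE (wk p k v) ((p ^ k : ℕ) * m) (algebraMap K E a) := by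
  obtain ⟨m, hm⟩ := hK a ha
  refine ⟨m, ?_⟩
  unfold gE wk at *
  rw [hm, nsmul_coe]; push_cast; rfl

theorem wk_unif (hp : 0 < p) (hπ : v π = ((((p : ℚ) ^ k)⁻¹ : ℚ) : WithTop ℚ)) :
    gE (wk p k v) 1 π := by
  unfold gE wk
  have hp' : (p : ℚ) ≠ 0 := by exact_mod_cast hp.ne'
  rw [hπ, nsmul_coe, WithTop.coe_eq_coe]
  push_cast
  field_simp

theorem mkInt (hp : p.Prime) (h : LV v)
    (hK : ∀ a : K, a ≠ 0 → ∃ m : ℤ, gE v m (algebraMap K E a))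
    (hd : Module.finrank K E = p ^ k) (hπ : gE (wk p k v) 1 π) (x : E) (hx : x ≠ 0) :
    ∃ m : ℤ, gE (wk p k v) m x :=
  expand_int (h.wk hp.ne_zero k) (wkK hK) hπ hd x hx

theorem mkLev (hp : p.Prime) (hodd : Odd p) (h : LV v) (hvp : v (p : E) = 1)
    (hK : ∀ a : K, a ≠ 0 → ∃ m : ℤ, gE v m (algebraMap K E a))
    (hd : Module.finrank K E = p ^ k) (hπ : gE (wk p k v) 1 π)
    (hinv : ∀ x, v (σ x) = v x) (hfix : ∀ a : K, σ (algebraMap K E a) = algebraMap K E a)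
    (hord : σ ^ (p ^ k) = 1) (hprim : 1 ≤ k → (σ ^ (p ^ (k - 1))) π ≠ π) :
    Lev p k (wk p k v) σ π where
  pre :=
    { val := h.wk hp.ne_zero k
      prime := hp
      wp := by
        unfold gE wk
        rw [hvp, show (1 : WithTop ℚ) = ((1 : ℚ) : WithTop ℚ) from rfl, nsmul_coe]
        push_cast; simp
      inv := fun x => by unfold wk; rw [hinv]
      unif := hπ
      int := mkInt hp h hK hd hπ
      res := fun x hx => by
        obtain ⟨a, ha⟩ := expand_res (h.wk hp.ne_zero k) (wkK hK) hπ hd (pow_pos hp.pos k) x hx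
        exact ⟨_, hfix a, ha⟩ }
  odd := hodd
  ord := hord
  prim := hprim

end mk

section tower
variable {K L : Type} [Field K] [Field L] [Algebra K L] [FiniteDimensional K L] [IsGalois K L]
  {v : L → WithTop ℚ} {p n : ℕ} {π : L}

def rh (σ : L ≃ₐ[K] L) : L →+* L := (σ : L →+* L)

theorem rh_apply (σ : L ≃ₐ[K] L) (x : L) : rh σ x = σ x := rfl

theorem rh_pow (σ : L ≃ₐ[K] L) (i : ℕ) (x : L) : (rh σ ^ i) x = (σ ^ i) x := by
  induction i generalizing x with
  | zero => rfl
  | succ i ih => rw [pow_succ, pow_succ, RingHom.mul_def, RingHom.comp_apply, ih]; rfl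

def FF (σ : L ≃ₐ[K] L) (q : ℕ) : IntermediateField K L :=
  IntermediateField.fixedField (Subgroup.zpowers (σ ^ q))

theorem mem_FF (σ : L ≃ₐ[K] L) (q : ℕ) (x : L) : x ∈ FF σ q ↔ (σ ^ q) x = x := by
  unfold FF
  rw [IntermediateField.mem_fixedField_iff]
  constructor
  · intro h
    exact h _ (Subgroup.mem_zpowers _)
  · intro h f hf
    have h1 : Subgroup.zpowers (σ ^ q) ≤ MulAction.stabilizer (L ≃ₐ[K] L) x := by
      rw [Subgroup.zpowers_le]
      exact h
    exact h1 hf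

theorem FF_finrank (hp : p.Prime) (σ : L ≃ₐ[K] L) (ho : orderOf σ = p ^ n)
    (hd : Module.finrank K L = p ^ n) (k : ℕ) (hk : k ≤ n) :
    Module.finrank K (FF σ (p ^ k)) = p ^ k := by
  have h1 : Module.finrank (FF σ (p ^ k)) L = p ^ (n - k) := by
    unfold FF
    rw [IntermediateField.finrank_fixedField_eq_card, Nat.card_zpowers,
      orderOf_pow_of_dvd (pow_ne_zero k hp.ne_zero) (by rw [ho]; exact pow_dvd_pow p hk), ho,
      Nat.pow_div hk hp.pos]
  have h2 := Module.finrank_mul_finrank K (FF σ (p ^ k)) L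
  rw [h1, hd] at h2
  have h3 : p ^ n = p ^ k * p ^ (n - k) := by rw [← pow_add]; congr 1; omega
  rw [h3] at h2
  exact Nat.eq_of_mul_eq_mul_right (pow_pos hp.pos _) h2

theorem FF_unif (hp : p.Prime) (h : LV v) (σ : L ≃ₐ[K] L) (ho : orderOf σ = p ^ n)
    (hinv : ∀ x, v (σ x) = v x) (hπ : v π = ((((p : ℚ) ^ n)⁻¹ : ℚ) : WithTop ℚ))
    (k : ℕ) (hk : k ≤ n) : ∃ x : L, (σ ^ (p ^ k)) x = x ∧
      v x = ((((p : ℚ) ^ k)⁻¹ : ℚ) : WithTop ℚ) := by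
  have hinvi : ∀ i : ℕ, ∀ x, v ((σ ^ i) x) = v x := by
    intro i
    induction i with
    | zero => intro x; rfl
    | succ i ih => intro x; rw [pow_succ', AlgEquiv.mul_apply, hinv, ih]
  refine ⟨∏ i ∈ Finset.range (p ^ (n - k)), ((σ ^ (p ^ k)) ^ i) π, ?_, ?_⟩
  · rw [map_prod]
    have h1 : ∀ i, (σ ^ (p ^ k)) (((σ ^ (p ^ k)) ^ i) π) = ((σ ^ (p ^ k)) ^ (i + 1)) π :=
      fun i => by rw [pow_succ']; rfl
    simp only [h1]
    have h2 := Finset.prod_range_succ (fun i => ((σ ^ (p ^ k)) ^ i) π) (p ^ (n - k))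
    rw [Finset.prod_range_succ' (fun i => ((σ ^ (p ^ k)) ^ i) π)] at h2
    have h3 : (σ ^ (p ^ k)) ^ (p ^ (n - k)) = 1 := by
      rw [← pow_mul, ← pow_add, show k + (n - k) = n by omega, ← ho, pow_orderOf_eq_one]
    rw [h3, pow_zero] at h2
    refine mul_right_cancel₀ ?_ h2
    intro h0
    have : π = 0 := h0
    rw [this, h.zero] at hπ
    exact absurd hπ WithTop.top_ne_coe
  · rw [h.prod]
    have : ∀ i, v (((σ ^ (p ^ k)) ^ i) π) = ((((p : ℚ) ^ n)⁻¹ : ℚ) : WithTop ℚ) := fun i => by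
      rw [← pow_mul, hinvi, hπ]
    simp only [this, Finset.sum_const, Finset.card_range]
    rw [nsmul_coe, WithTop.coe_eq_coe]
    have hp' : (p : ℚ) ≠ 0 := by exact_mod_cast hp.ne_zero
    push_cast
    have h3 : (p : ℚ) ^ n = p ^ k * p ^ (n - k) := by rw [← pow_add]; congr 1; omega
    rw [h3]
    field_simp

theorem FF_int (hp : p.Prime) (h : LV v)
    (hK : ∀ a : K, a ≠ 0 → ∃ m : ℤ, gE v m (algebraMap K L a))
    (σ : L ≃ₐ[K] L) (ho : orderOf σ = p ^ n) (hd : Module.finrank K L = p ^ n)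
    (hinv : ∀ x, v (σ x) = v x) (hπ : v π = ((((p : ℚ) ^ n)⁻¹ : ℚ) : WithTop ℚ))
    (k : ℕ) (hk : k ≤ n) (x : L) (hx : (σ ^ (p ^ k)) x = x) (hx0 : x ≠ 0) :
    ∃ m : ℤ, gE (wk p k v) m x := by
  obtain ⟨y, hy, hvy⟩ := FF_unif hp h σ ho hinv hπ k hk
  let F := FF σ (p ^ k)
  have hF : LV (fun x : F => v x) :=
    { top := fun x => by rw [h.top]; simp
      mul := fun x y => h.mul _ _
      add := fun x y => h.add _ _ }
  have := mkInt (K := K) (E := F) (v := fun x : F => v x) (p := p) (k := k)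
    (π := ⟨y, (mem_FF _ _ _).2 hy⟩) hp hF hK (FF_finrank hp σ ho hd k hk) (wk_unif hp.pos hvy)
    ⟨x, (mem_FF _ _ _).2 hx⟩ (fun h0 => hx0 (congrArg Subtype.val h0))
  exact this

theorem prim_of (hp : p.Prime) (h : LV v)
    (hK : ∀ a : K, a ≠ 0 → ∃ m : ℤ, gE v m (algebraMap K L a))
    (σ : L ≃ₐ[K] L) (ho : orderOf σ = p ^ n) (hd : Module.finrank K L = p ^ n)
    (hinv : ∀ x, v (σ x) = v x) (hπ : v π = ((((p : ℚ) ^ n)⁻¹ : ℚ) : WithTop ℚ))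
    (k : ℕ) (hk : k ≤ n) (hk1 : 1 ≤ k) (x : L) (hx : gE (wk p k v) 1 x) :
    (σ ^ (p ^ (k - 1))) x ≠ x := by
  intro hc
  obtain ⟨m, hm⟩ := FF_int hp h hK σ ho hd hinv hπ (k - 1) (by omega) x hc
    ((h.wk hp.ne_zero k).E_ne hx)
  rw [← wk_E hp.pos, Nat.sub_add_cancel hk1] at hm
  have h1 := hm.uniq hx
  have h2 : (p : ℤ) ∣ 1 := ⟨m, h1.symm⟩
  have := Int.le_of_dvd (by norm_num) h2
  have := hp.two_le
  omega

theorem top_lev (hp : p.Prime) (hodd : Odd p) (h : LV v) (hvp : v (p : L) = 1)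
    (hK : ∀ a : K, a ≠ 0 → ∃ m : ℤ, gE v m (algebraMap K L a))
    (σ : L ≃ₐ[K] L) (ho : orderOf σ = p ^ n) (hd : Module.finrank K L = p ^ n)
    (hinv : ∀ x, v (σ x) = v x) (hπ : v π = ((((p : ℚ) ^ n)⁻¹ : ℚ) : WithTop ℚ)) :
    Lev p n (wk p n v) (rh σ) π := by
  refine mkLev hp hodd h hvp hK hd (wk_unif hp.pos hπ) hinv (fun a => σ.commutes a) ?_ ?_
  · ext x
    rw [rh_pow, ← ho, pow_orderOf_eq_one]; rfl
  · intro h1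
    rw [rh_pow]
    exact prim_of hp h hK σ ho hd hinv hπ n le_rfl h1 π (wk_unif hp.pos hπ)

theorem FF_lev (hp : p.Prime) (hodd : Odd p) (h : LV v) (hvp : v (p : L) = 1)
    (hK : ∀ a : K, a ≠ 0 → ∃ m : ℤ, gE v m (algebraMap K L a))
    (σ : L ≃ₐ[K] L) (ho : orderOf σ = p ^ n) (hd : Module.finrank K L = p ^ n)
    (hinv : ∀ x, v (σ x) = v x) (hπ : v π = ((((p : ℚ) ^ n)⁻¹ : ℚ) : WithTop ℚ))
    (k : ℕ) (hk : k ≤ n) :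
    ∃ (s : FF σ (p ^ k) →+* FF σ (p ^ k)) (y : FF σ (p ^ k)),
      (∀ (i : ℕ) x, (((s ^ i) x : FF σ (p ^ k)) : L) = (rh σ ^ i) x) ∧
      Lev p k (wk p k fun x : FF σ (p ^ k) => v x) s y := by
  obtain ⟨y, hy, hvy⟩ := FF_unif hp h σ ho hinv hπ k hk
  let F := FF σ (p ^ k)
  have hF : LV (fun x : F => v x) :=
    { top := fun x => by rw [h.top]; simp
      mul := fun x y => h.mul _ _
      add := fun x y => h.add _ _ }
  let s : F →+* F := (rh σ).restrict F F (fun x hx => by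
    have h1 := (mem_FF _ _ _).1 hx
    refine (mem_FF _ _ _).2 ?_
    rw [rh_apply, ← AlgEquiv.mul_apply, ← pow_succ, pow_succ', AlgEquiv.mul_apply, h1])
  have hs1 : ∀ x : F, ((s x : F) : L) = rh σ x := fun x => rfl
  have hs : ∀ (i : ℕ) (x : F), (((s ^ i) x : F) : L) = (rh σ ^ i) x := by
    intro i
    induction i with
    | zero => intro x; rfl
    | succ i ih =>
      intro x
      rw [pow_succ', pow_succ', RingHom.mul_def, RingHom.comp_apply, hs1, ih]; rfl
  refine ⟨s, ⟨y, (mem_FF _ _ _).2 hy⟩, hs, ?_⟩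
  refine mkLev (K := K) hp hodd hF (by simpa using hvp) hK (FF_finrank hp σ ho hd k hk)
    (wk_unif hp.pos hvy) (fun x => by rw [hs1]; exact hinv _) ?_ ?_ ?_
  · intro a
    apply Subtype.ext
    exact σ.commutes a
  · ext x
    rw [hs, rh_pow, (mem_FF _ _ _).1 x.2]; rfl
  · intro h1 hc
    have h2 := congrArg Subtype.val hc
    rw [hs, rh_pow] at h2
    exact prim_of hp h hK σ ho hd hinv hπ k hk h1 y (wk_unif hp.pos hvy) h2

theorem mkTow (hp : p.Prime) (hodd : Odd p) (h : LV v) (hvp : v (p : L) = 1)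
    (hK : ∀ a : K, a ≠ 0 → ∃ m : ℤ, gE v m (algebraMap K L a))
    (σ : L ≃ₐ[K] L) (ho : orderOf σ = p ^ n) (hd : Module.finrank K L = p ^ n)
    (hinv : ∀ x, v (σ x) = v x) (hπ : v π = ((((p : ℚ) ^ n)⁻¹ : ℚ) : WithTop ℚ)) :
    Tow p n v (rh σ) := by
  have key : ∀ k < n, ∀ x, ((rh σ) ^ (p ^ (k + 1))) x = x →
      ∃ (s : FF σ (p ^ (k + 1)) →+* FF σ (p ^ (k + 1))) (y x' : FF σ (p ^ (k + 1))),
        (x' : L) = x ∧ Lev p (k + 1) (wk p (k + 1) fun x : FF σ (p ^ (k + 1)) => v x) s y ∧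
        ((Phi p (s ^ (p ^ k)) x' : FF σ (p ^ (k + 1))) : L) = Phi p (rh σ ^ (p ^ k)) x := by
    intro k hk x hx
    obtain ⟨s, y, hs, hl⟩ := FF_lev hp hodd h hvp hK σ ho hd hinv hπ (k + 1) hk
    rw [rh_pow] at hx
    refine ⟨s, y, ⟨x, (mem_FF _ _ _).2 hx⟩, rfl, hl, ?_⟩
    unfold Phi
    rw [AddSubmonoidClass.coe_finset_sum]
    apply Finset.sum_congr rfl
    intro i _
    rw [← pow_mul, hs, ← pow_mul]
  refine ⟨h, hp, hvp, ?_, ?_, ?_, ?_⟩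
  · intro k hk x hx hx0
    rw [rh_pow] at hx
    exact FF_int hp h hK σ ho hd hinv hπ k hk x hx hx0
  · intro k hk x hx m hm hg
    obtain ⟨s, y, x', rfl, hl, e⟩ := key k hk x hx
    rw [← e]
    exact hl.phi0 (j := k) (by omega) hm hg
  · intro k hk x hx m hm hd hg
    obtain ⟨s, y, x', rfl, hl, e⟩ := key k hk x hx
    rw [← e]
    exact hl.phi1 (j := k) (by omega) hm hd hg
  · intro k hk x hx m hm hd hg
    obtain ⟨s, y, x', rfl, hl, e⟩ := key k hk x hx
    rw [← e]
    exact hl.phiE (j := k) (by omega) hm hd hg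

end tower

section cyc
open Polynomial

variable {A : Type} [Field A] {u : A → WithTop ℚ} {p n : ℕ}

theorem val_root (h : LV u) {x : A} {N : ℕ} (hN : N ≠ 0) (hx : x ^ N = 1) : u x = 0 := by
  have h1 := h.pow x N
  rw [hx, h.one] at h1
  have hx0 : u x ≠ ⊤ := fun h' => by
    rw [(h.top x).1 h', zero_pow hN] at hx
    exact zero_ne_one hx
  lift u x to ℚ using hx0 with q hq
  rw [nsmul_coe] at h1
  have h2 : (N : ℚ) * q = 0 := by exact_mod_cast h1.symm
  have h3 : (N : ℚ) ≠ 0 := by exact_mod_cast hN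
  have : q = 0 := by simpa [h3] using h2
  rw [this]; rfl

theorem val_pow_sub_one (h : LV u) {x : A} (hx : 0 ≤ u x) (k : ℕ) : u (x - 1) ≤ u (x ^ k - 1) := by
  rw [← geom_sum_mul, h.mul]
  have : 0 ≤ u (∑ i ∈ Finset.range k, x ^ i) := by
    apply h.ge_sum
    intro i _
    rw [h.pow]
    exact nsmul_nonneg hx i
  calc u (x - 1) = 0 + u (x - 1) := (zero_add _).symm
    _ ≤ _ := by gcongr

theorem val_prim_eq (h : LV u) {N : ℕ} (hN : N ≠ 0) {ζ η : A} (hζ : IsPrimitiveRoot ζ N)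
    (hη : IsPrimitiveRoot η N) : u (ζ - 1) ≤ u (η - 1) := by
  have : NeZero N := ⟨hN⟩
  obtain ⟨i, -, rfl⟩ := hζ.eq_pow_of_pow_eq_one hη.pow_eq_one
  exact val_pow_sub_one h (val_root h hN hζ.pow_eq_one).ge i

theorem cyc_val (h : LV u) (hp : p.Prime) (hup : u (p : A) = 1) (hn : 1 ≤ n) {ζ : A}
    (hζ : IsPrimitiveRoot ζ (p ^ n)) : Nat.totient (p ^ n) • u (ζ - 1) = 1 := by
  have := Fact.mk hp
  have hN : p ^ n ≠ 0 := pow_ne_zero n hp.ne_zero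
  have h1 : eval 1 (cyclotomic (p ^ n) A) = p := by
    obtain ⟨k, rfl⟩ : ∃ k, n = k + 1 := ⟨n - 1, by omega⟩
    exact eval_one_cyclotomic_prime_pow k
  rw [cyclotomic_eq_prod_X_sub_primitiveRoots hζ, eval_prod] at h1
  have h2 := congrArg u h1
  rw [h.prod, hup] at h2
  rw [← h2, Finset.sum_congr rfl (g := fun _ => u (ζ - 1)), Finset.sum_const,
    hζ.card_primitiveRoots]
  intro η hη
  have hη' := (mem_primitiveRoots (Nat.pos_of_ne_zero hN)).1 hη
  simp only [eval_sub, eval_X, eval_C]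
  rw [← neg_sub, h.neg]
  exact le_antisymm (val_prim_eq h hN hη' hζ) (val_prim_eq h hN hζ hη')

theorem cyc_pos (h : LV u) (hp : p.Prime) (hup : u (p : A) = 1) (hn : 1 ≤ n) {ζ : A}
    (hζ : IsPrimitiveRoot ζ (p ^ n)) : 0 < u (ζ - 1) := by
  have h1 := cyc_val h hp hup hn hζ
  by_contra hc
  push Not at hc
  have h2 := nsmul_nonpos hc (Nat.totient (p ^ n))
  rw [h1] at h2
  exact absurd h2 (by decide +revert)

theorem scale_LV (h : LV u) {N : ℕ} (hN : N ≠ 0) : LV (fun x => N • u x) where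
  top x := by
    rw [← h.top]
    cases hv : u x with
    | top => simp [nsmul_top hN]
    | coe q => rw [nsmul_coe]; exact iff_of_false WithTop.coe_ne_top WithTop.coe_ne_top
  mul x y := by simp only [h.mul, nsmul_add]
  add x y := by
    rcases le_total (u x) (u y) with h1 | h1
    · exact le_trans (min_le_left _ _) (nsmul_le_nsmul_right ((min_eq_left h1) ▸ h.add x y) N)
    · exact le_trans (min_le_right _ _) (nsmul_le_nsmul_right ((min_eq_right h1) ▸ h.add x y) N)

theorem cyc_minpoly {K : Type} [Field K] [Algebra K A] (h : LV u) (hp : p.Prime)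
    (hup : u (p : A) = 1) (hn : 1 ≤ n) {ζ : A} (hζ : IsPrimitiveRoot ζ (p ^ n))
    (hK : ∀ a : K, a ≠ 0 → ∃ m : ℤ, gE u m (algebraMap K A a)) :
    minpoly K ζ = cyclotomic (p ^ n) K := by
  have hN : 0 < p ^ n := pow_pos hp.pos n
  have hroot : aeval ζ (cyclotomic (p ^ n) K) = 0 := by
    rw [aeval_def, eval₂_eq_eval_map, map_cyclotomic]
    have : NeZero (p ^ n) := ⟨hN.ne'⟩
    exact hζ.isRoot_cyclotomic hN
  have hint : IsIntegral K ζ := ⟨_, cyclotomic.monic _ K, hroot⟩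
  refine (Polynomial.eq_of_monic_of_dvd_of_natDegree_le (minpoly.monic hint)
    (cyclotomic.monic _ K) (minpoly.dvd K ζ hroot) ?_).symm
  rw [natDegree_cyclotomic]
  by_contra hc
  push Not at hc
  set φ := Nat.totient (p ^ n) with hφ
  have hφ0 : φ ≠ 0 := (Nat.totient_pos.2 hN).ne'
  have hw := scale_LV h hφ0
  have hπ : gE (fun x => φ • u x) 1 (ζ - 1) := by
    unfold gE
    show φ • u (ζ - 1) = _
    rw [hφ, cyc_val h hp hup hn hζ]; norm_num
  have hK' : ∀ a : K, a ≠ 0 → ∃ m : ℤ, gE (fun x => φ • u x) (φ * m) (algebraMap K A a) := by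
    intro a ha
    obtain ⟨m, hm⟩ := hK a ha
    refine ⟨m, ?_⟩
    unfold gE at hm ⊢
    show φ • u _ = _
    rw [hm, nsmul_coe]; push_cast; rfl
  set Q := (minpoly K ζ).comp (X + C 1) with hQ
  have hQm : Q.Monic := (minpoly.monic hint).comp_X_add_C 1
  have hQd : Q.natDegree = (minpoly K ζ).natDegree := by
    rw [hQ, natDegree_comp, natDegree_X_add_C, mul_one]
  have hQ0 : aeval (ζ - 1) Q = 0 := by
    rw [hQ, aeval_comp]; simp
  rw [aeval_eq_sum_range] at hQ0
  simp only [Algebra.smul_def] at hQ0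
  rcases expand_val hw hK' hπ Q.coeff (Q.natDegree + 1) (by omega) with h1 | ⟨m, j, -, -, hE, -⟩
  · have := h1 Q.natDegree (by omega)
    rw [hQm.coeff_natDegree] at this
    exact one_ne_zero this
  · exact hw.E_ne hE hQ0

end cyc

section conj
open Polynomial IntermediateField

variable {K L A : Type} [Field K] [Field L] [Field A] [Algebra K L] [Algebra K A]
  [FiniteDimensional K L] [IsGalois K L] {u : A → WithTop ℚ} {p n : ℕ}

theorem exists_conj (h : LV u) (hp : p.Prime)
    (hup : u (p : A) = 1) (hn : 1 ≤ n) {ζ : A} (hζ : IsPrimitiveRoot ζ (p ^ n))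
    (hK : ∀ a : K, a ≠ 0 → ∃ m : ℤ, gE u m (algebraMap K A a)) (f : L →ₐ[K] A) :
    ∃ (M : IntermediateField K A) (θ : M ≃ₐ[K] M) (j : L →ₐ[K] M) (γ : L ≃ₐ[K] L) (z : M),
      FiniteDimensional K M ∧ (z : A) = ζ ∧ θ z = z⁻¹ ∧ (∀ x, (j x : A) = f x) ∧
      ∀ x, θ (j x) = j (γ x) := by
  have : NeZero (p ^ n) := ⟨pow_ne_zero n hp.ne_zero⟩
  have hm1 := cyc_minpoly h hp hup hn hζ hK
  have hm2 := cyc_minpoly h hp hup hn hζ.inv hK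
  have hint : IsIntegral K ζ := by
    by_contra hc
    rw [minpoly.eq_zero hc] at hm1
    exact cyclotomic_ne_zero _ K hm1.symm
  have hc : IsCyclotomicExtension {p ^ n} K K⟮ζ⟯ := by
    change IsCyclotomicExtension {p ^ n} K K⟮ζ⟯.toSubalgebra
    rw [IntermediateField.adjoin_simple_toSubalgebra_of_isAlgebraic hint.isAlgebraic]
    exact hζ.adjoin_isCyclotomicExtension K
  have hN1 : Normal K K⟮ζ⟯ := (IsCyclotomicExtension.isGalois {p ^ n} K K⟮ζ⟯).to_normal
  have hN2 : Normal K f.fieldRange := Normal.of_algEquiv (AlgEquiv.ofInjectiveField f)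
  have hf1 : FiniteDimensional K K⟮ζ⟯ := IntermediateField.adjoin.finiteDimensional hint
  have hf2 : FiniteDimensional K f.fieldRange :=
    Module.Finite.equiv (AlgEquiv.ofInjectiveField f).toLinearEquiv
  let M : IntermediateField K A := f.fieldRange ⊔ K⟮ζ⟯
  have hM : FiniteDimensional K M := IntermediateField.finiteDimensional_sup _ _
  have hMn : Normal K M := inferInstance
  have hzM : ζ ∈ M := (le_sup_right : K⟮ζ⟯ ≤ M) (mem_adjoin_simple_self K ζ)
  let z : M := ⟨ζ, hzM⟩
  let j : L →ₐ[K] M := f.codRestrict M.toSubalgebra (fun x =>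
    (le_sup_left : f.fieldRange ≤ M) ⟨x, rfl⟩)
  have hconj : IsConjRoot K z⁻¹ z := by
    show minpoly K z⁻¹ = minpoly K z
    have e1 : minpoly K z = minpoly K ζ := minpoly_eq z
    have e2 : minpoly K z⁻¹ = minpoly K ζ⁻¹ := minpoly_eq z⁻¹
    rw [e1, e2, hm1, hm2]
  obtain ⟨θ, hθ⟩ := isConjRoot_iff_exists_algEquiv.1 hconj
  let : Algebra L M := j.toRingHom.toAlgebra
  have : IsScalarTower K L M := IsScalarTower.of_algebraMap_eq (fun x => (j.commutes x).symm)
  refine ⟨M, θ, j, θ.restrictNormal L, z, hM, rfl, hθ, fun x => rfl, fun x => ?_⟩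
  exact (θ.restrictNormal_commutes L x).symm

variable [Fact p.Prime] [Algebra ℚ_[p] K] [FiniteDimensional ℚ_[p] K]

theorem conj_res (hp : Odd p) (h : LV u)
    (hup : u (p : A) = 1) (hn : 1 ≤ n) {ζ : A} (hζ : IsPrimitiveRoot ζ (p ^ n))
    (hK : ∀ a : K, a ≠ 0 → ∃ m : ℤ, gE u m (algebraMap K A a)) (f : L →ₐ[K] A)
    (χ : (L ≃ₐ[K] L) →* A) (hχ : ∀ γ, ∃ i : ℕ, χ γ = ζ ^ i) (α : L) :
    u (∑ γ, χ γ * f (γ α)) = u (∑ γ, (χ γ)⁻¹ * f (γ α)) := by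
  have hpp : p.Prime := Fact.out
  obtain ⟨M, θ, j, γ, z, hM, hz, hθ, hj, hθj⟩ := exists_conj h hpp hup hn hζ hK f
  let : Algebra ℚ_[p] M := ((algebraMap K M).comp (algebraMap ℚ_[p] K)).toAlgebra
  have : IsScalarTower ℚ_[p] K M := IsScalarTower.of_algebraMap_eq (fun x => rfl)
  have : FiniteDimensional ℚ_[p] M := FiniteDimensional.trans ℚ_[p] K M
  have hLV : LV (fun x : M => u x) :=
    { top := fun x => by rw [h.top]; simp
      mul := fun x y => h.mul _ _
      add := fun x y => h.add _ _ }
  have hinv : ∀ x : M, u (θ x : M) = u x := fun x =>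
    val_inv (M := M) (w := fun x : M => u x) hp hLV (by simpa using hup)
      (fun x hx => hK (algebraMap ℚ_[p] K x) (by simpa using hx)) (θ.restrictScalars ℚ_[p]) x
  choose e he using hχ
  have h1 : ((∑ δ, z ^ (e δ) * j (δ α) : M) : A) = ∑ δ, χ δ * f (δ α) := by
    rw [AddSubmonoidClass.coe_finset_sum]
    refine Finset.sum_congr rfl fun δ _ => ?_
    simp [he, hz, hj]
  have h2 : ((θ (∑ δ, z ^ (e δ) * j (δ α)) : M) : A)
      = χ γ * ∑ δ, (χ δ)⁻¹ * f (δ α) := by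
    rw [map_sum, AddSubmonoidClass.coe_finset_sum, Finset.mul_sum,
      ← Equiv.sum_comp (Equiv.mulLeft γ) (fun δ => χ γ * ((χ δ)⁻¹ * f (δ α)))]
    refine Finset.sum_congr rfl fun δ _ => ?_
    have hne : ∀ δ, χ δ ≠ 0 := fun δ => by
      rw [he]; exact pow_ne_zero _ (hζ.ne_zero (pow_ne_zero n hpp.ne_zero))
    simp only [map_mul, map_pow, hθ, hθj, MulMemClass.coe_mul, hj, Equiv.coe_mulLeft,
      AlgEquiv.mul_apply]
    have : ((z⁻¹ ^ e δ : M) : A) = (χ δ)⁻¹ := by simp [he, hz]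
    rw [this]
    have h3 := hne γ
    field_simp
  rw [← h1, ← hinv, h2, h.mul, he γ, val_root h (pow_ne_zero n hpp.ne_zero), zero_add]
  rw [← pow_mul, mul_comm, pow_mul, hζ.pow_eq_one, one_pow]

end conj

section resolv
open Finset

theorem sum_cyc {G B : Type} [Group G] [Fintype G] [AddCommMonoid B] {σ : G}
    (hσ : ∀ x, x ∈ Subgroup.zpowers σ) (g : G → B) :
    ∑ γ, g γ = ∑ i ∈ range (orderOf σ), g (σ ^ i) := by
  classical
  rw [← IsCyclic.image_range_orderOf hσ, sum_image]
  intro a ha b hb hab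
  exact pow_injOn_Iio_orderOf (by simpa using ha) (by simpa using hb) hab

variable {K L A : Type} [Field K] [Field L] [Field A] [Algebra K L] [Algebra K A]
  [FiniteDimensional K L] [IsGalois K L] {u : A → WithTop ℚ} {p n : ℕ}

theorem res_mul (f : L →ₐ[K] A) (χ : (L ≃ₐ[K] L) →* A) (hne : ∀ γ, χ γ ≠ 0) (π : L) :
    (∑ γ, χ γ * f (γ π)) * (∑ γ, (χ γ)⁻¹ * f (γ π))
      = ∑ ε, χ ε * ∑ δ : L ≃ₐ[K] L, f (δ (ε π * π)) := by
  rw [sum_mul_sum, sum_comm]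
  simp only [mul_sum]
  conv_rhs => rw [sum_comm]
  refine sum_congr rfl fun δ _ => ?_
  rw [← Equiv.sum_comp (Equiv.mulLeft δ) (fun γ => χ γ * f (γ π) * ((χ δ)⁻¹ * f (δ π)))]
  refine sum_congr rfl fun ε _ => ?_
  simp only [Equiv.coe_mulLeft, map_mul, AlgEquiv.mul_apply]
  have := hne δ
  field_simp

variable [Fact p.Prime] [Algebra ℚ_[p] K] [FiniteDimensional ℚ_[p] K]

theorem L_inv (hp : Odd p) (h : LV u)
    (hup : u (p : A) = 1)
    (hK : ∀ a : K, a ≠ 0 → ∃ m : ℤ, gE u m (algebraMap K A a)) (f : L →ₐ[K] A)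
    (hLV : LV fun x => u (f x)) (σ : L ≃ₐ[K] L) (x : L) : u (f (σ x)) = u (f x) := by
  let : Algebra ℚ_[p] L := ((algebraMap K L).comp (algebraMap ℚ_[p] K)).toAlgebra
  have : IsScalarTower ℚ_[p] K L := IsScalarTower.of_algebraMap_eq (fun x => rfl)
  have : FiniteDimensional ℚ_[p] L := FiniteDimensional.trans ℚ_[p] K L
  exact val_inv (M := L) (w := fun x : L => u (f x)) hp hLV (by simpa using hup)
      (fun x hx => by
        have := hK (algebraMap ℚ_[p] K x) (by simpa using hx)
        rw [← f.commutes] at this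
        exact this) (σ.restrictScalars ℚ_[p]) x

theorem LV_comp (h : LV u) (f : L →ₐ[K] A) : LV fun x => u (f x) :=
  { top := fun x => by rw [h.top]; simp
    mul := fun x y => by rw [map_mul, h.mul]
    add := fun x y => by rw [map_add]; exact h.add _ _ }

theorem chi_prim (hn : 1 ≤ n) (χ : (L ≃ₐ[K] L) →* A) (hχ : orderOf χ = p ^ n) (σ : L ≃ₐ[K] L)
    (hσ : ∀ x, x ∈ Subgroup.zpowers σ) : IsPrimitiveRoot (χ σ) (p ^ n) := by
  classical
  rw [← hχ]
  have : orderOf χ = orderOf (χ σ) := by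
    apply orderOf_eq_orderOf_iff.2
    intro m
    constructor
    · intro h; rw [← MonoidHom.pow_apply, h, MonoidHom.one_apply]
    · intro h
      ext γ
      obtain ⟨i, -, rfl⟩ : ∃ i < orderOf σ, σ ^ i = γ := by
        have := mem_zpowers_iff_mem_range_orderOf.1 (hσ γ)
        simpa using this
      rw [MonoidHom.pow_apply, MonoidHom.one_apply, map_pow, ← pow_mul, mul_comm, pow_mul, h,
        one_pow]
  rw [this]
  exact IsPrimitiveRoot.orderOf _

theorem res_unif (hp : Odd p) (h : LV u) (hup : u (p : A) = 1) (hn : 1 ≤ n)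
    (hK : ∀ a : K, a ≠ 0 → ∃ m : ℤ, gE u m (algebraMap K A a)) (f : L →ₐ[K] A)
    (hcyc : IsCyclic (L ≃ₐ[K] L)) (hcard : Nat.card (L ≃ₐ[K] L) = p ^ n)
    (χ : (L ≃ₐ[K] L) →* A) (hχ : orderOf χ = p ^ n) {π : L}
    (hπ : u (f π) = ((((p : ℚ) ^ n)⁻¹ : ℚ) : WithTop ℚ)) :
    2 • u (∑ γ, χ γ * f (γ π)) = ((n + 1 : ℚ) : WithTop ℚ) := by
  classical
  have hpp : p.Prime := Fact.out
  obtain ⟨σ, hσ⟩ := hcyc.exists_generator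
  have ho : orderOf σ = p ^ n := by rw [orderOf_eq_card_of_forall_mem_zpowers hσ, hcard]
  have hd : Module.finrank K L = p ^ n := by rw [← IsGalois.card_aut_eq_finrank, hcard]
  have hLV := LV_comp h f
  have hinv := L_inv hp h hup hK f hLV
  have hvp : (fun x => u (f x)) (p : L) = 1 := by simpa using hup
  have hKL : ∀ a : K, a ≠ 0 → ∃ m : ℤ, gE (fun x => u (f x)) m (algebraMap K L a) := by
    intro a ha
    have := hK a ha
    rw [← f.commutes] at this
    exact this
  have hζ : IsPrimitiveRoot (χ σ) (p ^ n) := chi_prim hn χ hχ σ hσ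
  have hpow : ∀ γ, ∃ i : ℕ, γ = σ ^ i := fun γ => by
    have := mem_zpowers_iff_mem_range_orderOf.1 (hσ γ)
    simp only [mem_image] at this
    obtain ⟨i, -, hi⟩ := this
    exact ⟨i, hi.symm⟩
  have hχp : ∀ γ, ∃ i : ℕ, χ γ = (χ σ) ^ i := fun γ => by
    obtain ⟨i, rfl⟩ := hpow γ
    exact ⟨i, map_pow _ _ _⟩
  have hne : ∀ γ, χ γ ≠ 0 := fun γ => by
    obtain ⟨i, hi⟩ := hχp γ
    rw [hi]; exact pow_ne_zero _ (hζ.ne_zero (pow_ne_zero n hpp.ne_zero))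
  have hω : ∑ i ∈ range p, (χ σ) ^ (p ^ (n - 1) * i) = 0 := by
    have h1 : IsPrimitiveRoot ((χ σ) ^ (p ^ (n - 1))) p :=
      hζ.pow (pow_pos hpp.pos n) (by rw [← pow_succ, Nat.sub_add_cancel hn])
    have := h1.geom_sum_eq_zero hpp.one_lt
    simpa only [pow_mul] using this
  have hfin := final_S (emb := (f : L →+* A)) (u := u)
    (mkTow hpp hp hLV hvp hKL σ ho hd (hinv σ) hπ)
    (top_lev hpp hp hLV hvp hKL σ ho hd (hinv σ) hπ) hn h hω (cyc_pos h hpp hup hn hζ)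
  have heq : (∑ γ, χ γ * f (γ π)) * (∑ γ, (χ γ)⁻¹ * f (γ π)) =
      ∑ i ∈ range (p ^ n), (χ σ) ^ i * (f : L →+* A) (Tr p n (rh σ) ((rh σ ^ i) π * π)) := by
    rw [res_mul f χ hne, sum_cyc hσ (fun ε => χ ε * ∑ δ : L ≃ₐ[K] L, f (δ (ε π * π))), ho]
    refine sum_congr rfl fun i _ => ?_
    rw [sum_cyc hσ (fun δ => f (δ ((σ ^ i) π * π))), ho, map_pow]
    unfold Tr
    rw [map_sum]
    simp only [rh_pow]
    rfl
  have hu := conj_res hp h hup hn hζ hK f χ hχp π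
  rw [← heq] at hfin
  unfold gE wk at hfin
  rw [h.mul, ← hu, pow_zero, one_smul, ← two_smul ℕ] at hfin
  rw [hfin]
  push_cast
  rfl

end resolv

section resolv2
open Finset
variable {K L A : Type} [Field K] [Field L] [Field A] [Algebra K L] [Algebra K A]
  [FiniteDimensional K L] [IsGalois K L] {u : A → WithTop ℚ} {p n : ℕ}

theorem unif_wk {v : L → WithTop ℚ} {k : ℕ} {π : L} (hp : 0 < p) (h : gE (wk p k v) 1 π) :
    v π = ((((p : ℚ) ^ k)⁻¹ : ℚ) : WithTop ℚ) := by
  unfold gE wk at h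
  have hp' : (p : ℚ) ≠ 0 := by exact_mod_cast hp.ne'
  cases hv : v π with
  | top => rw [hv, nsmul_top (pow_ne_zero _ hp.ne')] at h; exact absurd h WithTop.top_ne_coe
  | coe q =>
    rw [hv, nsmul_coe, WithTop.coe_eq_coe] at h
    rw [WithTop.coe_eq_coe]
    push_cast at h
    field_simp
    linarith

variable [Fact p.Prime] [Algebra ℚ_[p] K] [FiniteDimensional ℚ_[p] K]

theorem res_lower (hp : Odd p) (h : LV u) (hup : u (p : A) = 1) (hn : 1 ≤ n)
    (hK : ∀ a : K, a ≠ 0 → ∃ m : ℤ, gE u m (algebraMap K A a)) (f : L →ₐ[K] A)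
    (hcyc : IsCyclic (L ≃ₐ[K] L)) (hcard : Nat.card (L ≃ₐ[K] L) = p ^ n)
    (χ : (L ≃ₐ[K] L) →* A) (hχ : orderOf χ = p ^ n) {π : L}
    (hπ : u (f π) = ((((p : ℚ) ^ n)⁻¹ : ℚ) : WithTop ℚ)) (α : L) (hα : 0 ≤ u (f α)) :
    ((n + 1 : ℚ) : WithTop ℚ) ≤ 2 • u (∑ γ, χ γ * f (γ α)) := by
  classical
  have hpp : p.Prime := Fact.out
  have hunif : ∀ {x : L}, gE (wk p n fun x => u (f x)) 1 x →
      2 • u (∑ γ, χ γ * f (γ x)) = ((n + 1 : ℚ) : WithTop ℚ) := fun {x} hx =>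
    res_unif hp h hup hn hK f hcyc hcard χ hχ (unif_wk (v := fun x => u (f x)) hpp.pos hx)
  obtain ⟨σ, hσ⟩ := hcyc.exists_generator
  have ho : orderOf σ = p ^ n := by rw [orderOf_eq_card_of_forall_mem_zpowers hσ, hcard]
  have hd : Module.finrank K L = p ^ n := by rw [← IsGalois.card_aut_eq_finrank, hcard]
  have hLV := LV_comp h f
  have hinv := L_inv hp h hup hK f hLV
  have hvp : (fun x => u (f x)) (p : L) = 1 := by simpa using hup
  have hKL : ∀ a : K, a ≠ 0 → ∃ m : ℤ, gE (fun x => u (f x)) m (algebraMap K L a) := by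
    intro a ha
    have := hK a ha
    rw [← f.commutes] at this
    exact this
  have hζ : IsPrimitiveRoot (χ σ) (p ^ n) := chi_prim hn χ hχ σ hσ
  have hlev := (top_lev hpp hp hLV hvp hKL σ ho hd (hinv σ) hπ).pre
  set w := wk p n fun x => u (f x) with hw
  have hα' : gG w 0 α := by
    unfold gG
    rw [hw]
    unfold wk
    simpa using nsmul_nonneg hα (p ^ n)
  obtain ⟨a, ha, hy⟩ := hlev.res α hα'
  have hR0 : ∑ γ, χ γ * f (γ a) = 0 := by
    rw [sum_cyc hσ (fun γ => χ γ * f (γ a)), ho]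
    have : ∀ i : ℕ, (σ ^ i) a = a := fun i => by
      rw [← rh_pow, pow_fix a ha]
    simp only [this, map_pow]
    rw [← sum_mul, hζ.geom_sum_eq_zero (Nat.one_lt_pow (by omega) hpp.one_lt), zero_mul]
  have hadd : ∀ x y : L, ∑ γ, χ γ * f (γ (x + y)) = ∑ γ, χ γ * f (γ x) + ∑ γ, χ γ * f (γ y) := by
    intro x y
    rw [← sum_add_distrib]
    refine sum_congr rfl fun γ _ => ?_
    simp only [map_add, mul_add]
  have hy2 : ((n + 1 : ℚ) : WithTop ℚ) ≤ 2 • u (∑ γ, χ γ * f (γ (α - a))) := by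
    by_cases h0 : α - a = 0
    · simp only [h0, map_zero, mul_zero, sum_const_zero, h.zero]
      rw [nsmul_top two_ne_zero]
      exact le_top
    obtain ⟨m, hm⟩ := hlev.int _ h0
    have hm1 := hm.le hy
    rcases hm1.eq_or_lt with rfl | hm2
    · exact (hunif hm).ge
    · have h1 : gE w 1 (π + (α - a)) := hlev.val.E_add hlev.unif hm.G hm2
      have h2 := hadd π (α - a)
      have h3 := (scale_LV h two_ne_zero).sub (∑ γ, χ γ * f (γ (π + (α - a))))
        (∑ γ, χ γ * f (γ π))
      rw [hunif h1, hunif hlev.unif, min_self, h2, add_sub_cancel_left] at h3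
      exact h3
  have := hadd a (α - a)
  rw [add_sub_cancel, hR0, zero_add] at this
  rw [this]
  exact hy2

end resolv2

section

theorem PadicValData.toLV {A : Type} [Field A] {p : ℕ} (vd : PadicValData A p) : LV vd.v :=
  ⟨vd.v_top_iff, vd.v_mul, vd.v_min_le_add⟩

theorem base_int {A : Type} [Field A] {p : ℕ} (vd : PadicValData A p) {F : Type} [Field F]
    (g : F →+* A) (hu : IsUniformizer vd g (p : F)) (x : F) (hx : x ≠ 0) :
    ∃ m : ℤ, gE vd.v m (g x) := by
  have h := vd.toLV
  have hp1 : gE vd.v 1 (g (p : F)) := by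
    unfold gE; rw [map_natCast, vd.v_coe_p]; norm_num
  have hpne : (p : F) ≠ 0 := hu.1
  have hgx : vd.v (g x) ≠ ⊤ := fun h' => by
    have := (h.top _).1 h'
    simp [hx] at this
  obtain ⟨q, hq⟩ := WithTop.ne_top_iff_exists.1 hgx
  have hzp : ∀ k : ℤ, gE vd.v k (g ((p : F) ^ k)) := by
    intro k
    obtain ⟨a, rfl | rfl⟩ := k.eq_nat_or_neg
    · simpa using h.E_pow hp1 a
    · have := h.E_div h.E_one (h.E_pow hp1 a)
      simpa using this
  refine ⟨⌊q⌋, ?_⟩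
  have hy : vd.v (g (x * (p : F) ^ (-⌊q⌋))) = ((q - ⌊q⌋ : ℚ) : WithTop ℚ) := by
    have h2 := hzp (-⌊q⌋)
    unfold gE at h2
    rw [map_mul, h.mul, ← hq, h2, ← WithTop.coe_add]
    push_cast
    rw [sub_eq_add_neg]
  have hf := Int.floor_le q
  have hlt := Int.lt_floor_add_one q
  unfold gE
  rw [← hq, WithTop.coe_eq_coe]
  by_contra hne
  have hpos : 0 < q - ⌊q⌋ := lt_of_le_of_ne (by linarith) (fun h' => hne (by linarith))
  have h3 := hu.2.2 (x * (p : F) ^ (-⌊q⌋)) (by rw [hy]; exact_mod_cast hpos)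
  rw [hy, hp1] at h3
  have : ((1 : ℤ) : ℚ) ≤ q - ⌊q⌋ := by exact_mod_cast h3
  push_cast at this
  linarith

/-- Theorem 2.9. Let `p` be an odd prime, `Ψ` an unramified (finite)
extension of `ℚ_p` with uniformizer `π`, and `Ψ_∞/Ψ` a totally ramified `ℤ_p`-extension
with `n`-th layer `Ψ_n`. Let `χ` be a finite character of `Gal(Ψ_∞/Ψ)` of order
`p^n > 1` (which thus factors through `Γ_n = Gal(Ψ_n/Ψ)`). Then
`v_π(⟨α|χ⟩_{Γ_n}) ≥ (n+1)/2` for every `α ∈ O_{Ψ_n}` (with cleared denominators: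
`(n+1)·v(π) ≤ 2·v(⟨α|χ⟩)`), and equality holds for every uniformizer `α` of `Ψ_n`. -/
theorem statement8 {p : ℕ} [Fact p.Prime] (hp : Odd p)
    {A : Type} [Field A] (vd : PadicValData A p)
    (Ψ Ψinf : Type) [Field Ψ] [Field Ψinf]
    [Algebra ℚ_[p] Ψ] [FiniteDimensional ℚ_[p] Ψ] [Algebra Ψ Ψinf]
    (emb : Ψinf →+* A)
    (hunram : IsUniformizer vd (emb.comp (algebraMap Ψ Ψinf)) (p : Ψ))
    (layer : ℕ → IntermediateField Ψ Ψinf)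
    (htower : IsZpExtensionTower vd Ψ Ψinf emb layer)
    (π : Ψ) (hπ : IsUniformizer vd (emb.comp (algebraMap Ψ Ψinf)) π)
    (n : ℕ) (hn : 1 ≤ n)
    (χ : (↥(layer n) ≃ₐ[Ψ] ↥(layer n)) →* A) (hχ : orderOf χ = p ^ n) :
    (∀ α : ↥(layer n),
      0 ≤ vd.v ((emb.comp ((layer n).val : ↥(layer n) →+* Ψinf)) α) →
      (n + 1) • vd.v ((emb.comp (algebraMap Ψ Ψinf)) π)
        ≤ 2 • vd.v (localResolvent Ψ ↥(layer n)
            (emb.comp ((layer n).val : ↥(layer n) →+* Ψinf)) (⇑χ) α)) ∧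
    (∀ α : ↥(layer n),
      IsUniformizer vd (emb.comp ((layer n).val : ↥(layer n) →+* Ψinf)) α →
      2 • vd.v (localResolvent Ψ ↥(layer n)
          (emb.comp ((layer n).val : ↥(layer n) →+* Ψinf)) (⇑χ) α)
        = (n + 1) • vd.v ((emb.comp (algebraMap Ψ Ψinf)) π)) := by
  have hpp : p.Prime := Fact.out
  obtain ⟨-, -, -, hgal, hcyc, hcard, hun⟩ := htower
  have h := vd.toLV
  have := hgal n
  have hfin : Finite (↥(layer n) ≃ₐ[Ψ] ↥(layer n)) :=
    Nat.finite_of_card_ne_zero (by rw [hcard]; exact pow_ne_zero n hpp.ne_zero)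
  have : FiniteDimensional Ψ (layer n) := IsGalois.finiteDimensional_of_finite Ψ (layer n)
  let : Algebra Ψ A := (emb.comp (algebraMap Ψ Ψinf)).toAlgebra
  let f : layer n →ₐ[Ψ] A :=
    { (emb.comp ((layer n).val : ↥(layer n) →+* Ψinf)) with commutes' := fun a => rfl }
  have hf : ∀ x, (emb.comp ((layer n).val : ↥(layer n) →+* Ψinf)) x = f x := fun x => rfl
  have hK : ∀ a : Ψ, a ≠ 0 → ∃ m : ℤ, gE vd.v m (algebraMap Ψ A a) :=
    base_int vd (emb.comp (algebraMap Ψ Ψinf)) hunram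
  have hpv : vd.v ((emb.comp (algebraMap Ψ Ψinf)) (p : Ψ)) = 1 := by
    rw [map_natCast]; exact vd.v_coe_p
  have hπ1 : (n + 1) • vd.v ((emb.comp (algebraMap Ψ Ψinf)) π) = ((n + 1 : ℚ) : WithTop ℚ) := by
    have : vd.v ((emb.comp (algebraMap Ψ Ψinf)) π) = 1 := by
      rw [← hpv]
      exact le_antisymm (hπ.2.2 _ hunram.2.1) (hunram.2.2 _ hπ.2.1)
    rw [this, show (1 : WithTop ℚ) = ((1 : ℚ) : WithTop ℚ) from rfl, nsmul_coe]
    push_cast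
    rw [mul_one]
  have hres : ∀ α, localResolvent Ψ ↥(layer n)
      (emb.comp ((layer n).val : ↥(layer n) →+* Ψinf)) (⇑χ) α = ∑ γ, χ γ * f (γ α) := by
    intro α
    unfold localResolvent
    rw [finsum_eq_sum_of_fintype]
    rfl
  obtain ⟨ϖ, hϖ, hϖv⟩ := hun n
  rw [hπ1]
  refine ⟨fun α hα => ?_, fun α hα => ?_⟩
  · rw [hres]
    exact res_lower hp h vd.v_coe_p hn hK f (hcyc n) (hcard n) χ hχ hϖv α hα
  · rw [hres]
    refine res_unif hp h vd.v_coe_p hn hK f (hcyc n) (hcard n) χ hχ ?_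
    rw [← hϖv]
    exact le_antisymm (hα.2.2 _ hϖ.2.1) (hϖ.2.2 _ hα.2.1)

end
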